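/- arXiv:2309.03880 — 2 statements merged into one kernel-verified Lean document; each statement's English description precedes it below -/
import Mathlib

section
/- Fix η∈(0,1). There exists K₀=K₀(η)<∞ such that for all K≥K₀, L≥1, u,v>0, and every nonempty 𝒞⊆Λ(L) whose points have mutual distance at least 16KL, the following holds, with Ĉ_z=B(z,8L), Σ(𝒞)=∪_{z∈𝒞}Ĉ_z and V(x)=∑_{z∈𝒞}e_{Σ(𝒞)}(Ĉ_z)·ē_{Ĉ_z}(x): for any nonnegative random field (ℓ_x)_{x∈G} satisfying the level-v interlacement Laplace identity, if u<v then P(∑_{x∈G}V(x)ℓ_x ≤ u·cap(Σ(𝒞))) ≤ exp(−(√v−√u)²·cap(Σ(𝒞))/(1+η)), and if u>v then P(∑_{x∈G}V(x)ℓ_x ≥ u·cap(Σ(𝒞))) ≤ exp(−(√u−√v)²·cap(Σ(𝒞))/(1+η)). In particular, since {∑_{x∈Ĉ_z}ē_{Ĉ_z}(x)ℓ_x ≥ u for all z∈𝒞} implies the second event and {∑_{x∈Ĉ_z}ē_{Ĉ_z}(x)ℓ_x ≤ u for all z∈𝒞} implies the first, with probability at least 1−exp(−(√v−√u)²cap(Σ(𝒞))/(1+η))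 some z∈𝒞 satisfies ∑_{x∈Ĉ_z}ē_{Ĉ_z}(x)ℓ_x > u when u<v (respectively < u when u>v). -/
open MeasureTheory Set Filter
open scoped ENNReal Topology Classical

noncomputable section

namespace Paper

variable {V : Type}

/-- Total weight at a vertex: `λ_x = ∑_y λ_{x,y}`. -/
def lamTot (lam : V → V → ℝ) (x : V) : ℝ := ∑' y, lam x y

/-- Closed ball for the distance `dd`. -/
def vball (dd : V → V → ℝ) (x : V) (r : ℝ) : Set V := {y | dd x y ≤ r}

/-- Trajectories that never return to `A` after time `0`, i.e. `H̃_A = ∞`. -/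
def avoidSet (A : Set V) : Set (ℕ → V) := {ω | ∀ k, 1 ≤ k → ω k ∉ A}

variable [MeasurableSpace V]

/-- Equilibrium measure `e_A(x) = λ_x P_x(H̃_A = ∞) 1{x ∈ A}`. -/
def equi (lam : V → V → ℝ) (P : V → Measure (ℕ → V)) (A : Set V) (x : V) : ℝ :=
  if x ∈ A then lamTot lam x * (P x (avoidSet A)).toReal else 0

/-- Capacity `cap(A) = ∑_{x ∈ A} e_A(x)`. -/
def capa (lam : V → V → ℝ) (P : V → Measure (ℕ → V)) (A : Set V) : ℝ :=
  ∑' x : A, equi lam P A x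

/-- Green function `g(x,y) = λ_y⁻¹ E_x[∑_k 1{X_k = y}]`. -/
def green (lam : V → V → ℝ) (P : V → Measure (ℕ → V)) (x y : V) : ℝ :=
  (lamTot lam y)⁻¹ * ∑' k : ℕ, (P x {ω | ω k = y}).toReal

/-- The standing assumptions on the weighted graph `(G,λ)` with distance `dd`,
random-walk law `P`, volume exponent `α`, Green exponent `ν` and asymptotic
Green constants `c₃ ≤ C₃`. -/
structure Standing (lam dd : V → V → ℝ) (P : V → Measure (ℕ → V))
    (α ν c₃ C₃ : ℝ) : Prop where
  countable : Countable V
  lam_symm : ∀ x y, lam x y = lam y x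
  lam_nonneg : ∀ x y, 0 ≤ lam x y
  lam_diag : ∀ x, lam x x = 0
  locFin : ∀ x, {y | 0 < lam x y}.Finite
  dd_self : ∀ x, dd x x = 0
  dd_pos : ∀ x y, x ≠ y → 0 < dd x y
  dd_symm : ∀ x y, dd x y = dd y x
  dd_triangle : ∀ x y z, dd x z ≤ dd x y + dd y z
  prob : ∀ x, IsProbabilityMeasure (P x)
  start : ∀ x, P x {ω | ω 0 = x} = 1
  step : ∀ x y, P x {ω | ω 1 = y} = ENNReal.ofReal (lam x y / lamTot lam x)
  markov : ∀ (x y : V) (k : ℕ) (S : Set (ℕ → V)), MeasurableSet S →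
    P x ({ω | ω k = y} ∩ {ω | (fun n => ω (k + n)) ∈ S}) = P x {ω | ω k = y} * P y S
  nu_pos : 0 < ν
  nu_le : ν ≤ α - 2
  vol : ∃ c₁ C₁ : ℝ, 0 < c₁ ∧ c₁ ≤ C₁ ∧ ∀ (x : V) (r : ℝ), 1 ≤ r →
    c₁ * r ^ α ≤ ∑' y : vball dd x r, lamTot lam y ∧
      ∑' y : vball dd x r, lamTot lam y ≤ C₁ * r ^ α
  greenBounds : ∃ c₂ C₂ : ℝ, 0 < c₂ ∧ c₂ ≤ C₂ ∧
    (∀ x, c₂ ≤ green lam P x x ∧ green lam P x x ≤ C₂) ∧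
    ∀ x y, x ≠ y → c₂ * dd x y ^ (-ν) ≤ green lam P x y ∧
      green lam P x y ≤ C₂ * dd x y ^ (-ν)
  c₃_pos : 0 < c₃
  c₃_le_C₃ : c₃ ≤ C₃
  greenAsymp : ∀ η' : ℝ, 0 < η' → ∃ M : ℝ, ∀ x y, M ≤ dd x y →
    (1 - η') * c₃ ≤ green lam P x y * dd x y ^ ν ∧
      green lam P x y * dd x y ^ ν ≤ (1 + η') * C₃
  p0 : ∃ c : ℝ, 0 < c ∧ ∀ x y, 0 < lam x y → c ≤ lam x y / lamTot lam x

/-- The geodesic assumption: from every point there is an infinite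
nearest-neighbour path along which `dd` is comparable to the index difference. -/
def Geodesic (lam dd : V → V → ℝ) (c₄ C₄ : ℝ) : Prop :=
  ∀ x : V, ∃ γ : ℕ → V, γ 0 = x ∧ (∀ k : ℕ, 0 < lam (γ k) (γ (k + 1))) ∧
    ∀ k p : ℕ, c₄ * |(k : ℝ) - (p : ℝ)| - C₄ ≤ dd (γ k) (γ p) ∧
      dd (γ k) (γ p) ≤ c₄ * |(k : ℝ) - (p : ℝ)| + C₄

/-- The function `F_ν(x,y)`. -/
def Fnu (ν x y : ℝ) : ℝ :=
  if ν < 1 then x ^ ν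
  else if ν = 1 then x / max 1 (Real.log (x / y))
  else x * y ^ (ν - 1)

/-- `F_ν(x) = F_ν(x,1)`. -/
def Fnu1 (ν x : ℝ) : ℝ := Fnu ν x 1

/-- The constant `π⁻¹ B((1+ν)/2,(1+ν)/2) cos(πν/2)` for `ν < 1` and `1/2` for `ν = 1`
(the Beta function expressed through `Γ`). -/
def kappaNu (ν : ℝ) : ℝ :=
  if ν < 1 then
    Real.Gamma ((1 + ν) / 2) * Real.Gamma ((1 + ν) / 2) / Real.Gamma (1 + ν)
      * Real.cos (Real.pi * ν / 2) / Real.pi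
  else 1 / 2

/-- `c_β`, defined by `c_β · C₃ = kappaNu ν`. -/
def cBeta (ν C₃ : ℝ) : ℝ := kappaNu ν / C₃

/-- `C_β`, defined by `C_β · c₃ = kappaNu ν`. -/
def CBeta (ν c₃ : ℝ) : ℝ := kappaNu ν / c₃

/-- `a` and `b` are joined by a nearest-neighbour path inside `S`. -/
def connIn (lam : V → V → ℝ) (S : Set V) (a b : V) : Prop :=
  ∃ (m : ℕ) (γ : ℕ → V), γ 0 = a ∧ γ m = b ∧ (∀ i ≤ m, γ i ∈ S) ∧
    ∀ i < m, 0 < lam (γ i) (γ (i + 1))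

/-- The set `X̄_A` of points visited by a trajectory strictly before exiting `A`. -/
def visited (A : Set V) (ω : ℕ → V) : Set V :=
  {v | ∃ k : ℕ, (∀ n ≤ k, ω n ∈ A) ∧ ω k = v}

/-- Properties of the renormalised families `Λ(L)`. -/
structure LamFamily (dd : V → V → ℝ) (α : ℝ) (Lam : ℝ → Set V) : Prop where
  cover : ∀ L : ℝ, 1 ≤ L → ∀ x : V, ∃ y ∈ Lam L, dd y x ≤ L
  card : ∃ CΛ : ℝ, 0 < CΛ ∧ ∀ L : ℝ, 1 ≤ L → ∀ (x : V) (N : ℝ), 1 ≤ N →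
    (Lam L ∩ vball dd x (L * N)).Finite ∧
      ((Lam L ∩ vball dd x (L * N)).ncard : ℝ) ≤ CΛ * N ^ α
  one : Lam 1 = Set.univ

/-- `γ 0, …, γ m` is an `L`-nearest-neighbour path in `Λ(L)`. -/
def IsLPath (lam dd : V → V → ℝ) (Lam : ℝ → Set V) (L : ℝ) (γ : ℕ → V) (m : ℕ) : Prop :=
  (∀ i ≤ m, γ i ∈ Lam L) ∧ ∀ i < m,
    (1 < L ∧ ∃ a b, dd (γ i) a ≤ L ∧ dd (γ (i + 1)) b ≤ L ∧ 0 < lam a b) ∨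
    (L = 1 ∧ 0 < lam (γ i) (γ (i + 1)))

/-- FPP distance between `x` and `y` for the weights `t` at level `u`. -/
def fppDist {Ω : Type} (lam dd : V → V → ℝ) (Lam : ℝ → Set V)
    (t : V → ℝ → Ω → ℝ) (R u : ℝ) (ω : Ω) (x y : V) : ℝ≥0∞ :=
  ⨅ (γ : ℕ → V) (m : ℕ) (_ : IsLPath lam dd Lam R γ m ∧ γ 0 = x ∧ γ m = y),
    ∑ i ∈ Finset.range (m + 1), ENNReal.ofReal (t (γ i) u ω)

/-- FPP distance `d_{t,u}(x;L,N)` between `B(x,L) ∩ Λ(R)` and `B(x,N)ᶜ ∩ Λ(R)`. -/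
def fppDistAnn {Ω : Type} (lam dd : V → V → ℝ) (Lam : ℝ → Set V)
    (t : V → ℝ → Ω → ℝ) (R u : ℝ) (ω : Ω) (x : V) (L N : ℝ) : ℝ≥0∞ :=
  ⨅ (y : V) (_ : y ∈ Lam R ∧ dd x y ≤ L) (z : V) (_ : z ∈ Lam R ∧ ¬ dd x z ≤ N),
    fppDist lam dd Lam t R u ω y z

/-- The operator `f ↦ ((GV)f)(x) = ∑_y g(x,y)V(y)f(y)`. -/
def GVop (gr : V → V → ℝ) (Vf : V → ℝ) (f : V → ℝ) : V → ℝ :=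
  fun x => ∑' y, gr x y * Vf y * f y

/-- `(ℓ_{x,u})_{x,u}` is the local-time field of random interlacements:
nonnegative, nondecreasing and right-continuous in the level, with independent
stationary increments, and satisfying the interlacement Laplace identity. -/
structure LocalTimes {Ω : Type} [MeasurableSpace Ω] (μ : Measure Ω)
    (gr : V → V → ℝ) (ℓ : V → ℝ → Ω → ℝ) : Prop where
  nonneg : ∀ x u ω, 0 ≤ ℓ x u ω
  mono : ∀ x ω, MonotoneOn (fun u => ℓ x u ω) (Set.Ioi (0 : ℝ))
  rightCont : ∀ (x : V) (ω : Ω) (u : ℝ), 0 < u →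
    ContinuousWithinAt (fun v => ℓ x v ω) (Set.Ici u) u
  indep : ∀ u v : ℝ, 0 < u → u < v →
    ProbabilityTheory.IndepFun
      (fun ω => (fun x : V => ℓ x v ω - ℓ x u ω))
      (fun ω => (fun q : V × {s : ℝ // 0 < s ∧ s ≤ u} => ℓ q.1 q.2.1 ω)) μ
  stationary : ∀ u v : ℝ, 0 < u → u < v →
    Measure.map (fun ω => (fun x : V => ℓ x v ω - ℓ x u ω)) μ
      = Measure.map (fun ω => (fun x : V => ℓ x (v - u) ω)) μ
  laplace : ∀ u : ℝ, 0 < u → ∀ Vf : V → ℝ, (Function.support Vf).Finite →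
    (∃ r : ℝ, r < 1 ∧ ∀ x : V, ∑' y, |gr x y * Vf y| ≤ r) →
    ∫ ω, Real.exp (∑' x, Vf x * ℓ x u ω) ∂μ
      = Real.exp (u * ∑' x, Vf x * (∑' n : ℕ, (GVop gr Vf)^[n] (fun _ => 1) x))

/-- Admissible family of weights built from the local times in `B(z,3R)`,
all increasing (`inc = true`) or all decreasing (`inc = false`). -/
structure Admissible {Ω : Type} (dd : V → V → ℝ) (Lam : ℝ → Set V)
    (ℓ : V → ℝ → Ω → ℝ) (R : ℝ) (t : V → ℝ → Ω → ℝ) (inc : Bool) : Prop where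
  repr : ∃ gz : V → (V → ℝ) → ℝ,
    (∀ z ∈ Lam R, ∀ f : V → ℝ, (∀ x, 0 ≤ f x) → 0 ≤ gz z f) ∧
    (if inc then ∀ z ∈ Lam R, Monotone (gz z) else ∀ z ∈ Lam R, Antitone (gz z)) ∧
    ∀ z ∈ Lam R, ∀ u : ℝ, 0 < u → ∀ ω : Ω,
      t z u ω = gz z (fun x => if dd z x ≤ 3 * R then ℓ x u ω else 0)

/-- The set `ℒ_Θ` of pairs of levels. -/
def LTheta (inc : Bool) (Θ u v : ℝ) : Prop :=
  if inc then 0 < u ∧ u < v ∧ v < Θ * u else 0 < v ∧ v < u ∧ u < Θ * v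

/-- `Σ(𝒞) = ∪_{z∈𝒞} B(z,8L)`. -/
def SigmaSet (dd : V → V → ℝ) (L : ℝ) (𝒞 : Set V) : Set V :=
  ⋃ z ∈ 𝒞, vball dd z (8 * L)

/-- `V(x) = ∑_{z∈𝒞} e_{Σ(𝒞)}(Ĉ_z) ē_{Ĉ_z}(x)`. -/
def Vfun (lam dd : V → V → ℝ) (P : V → Measure (ℕ → V)) (L : ℝ) (𝒞 : Set V)
    (x : V) : ℝ :=
  ∑' z : 𝒞, (∑' w : vball dd (z : V) (8 * L), equi lam P (SigmaSet dd L 𝒞) w) *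
    (equi lam P (vball dd (z : V) (8 * L)) x / capa lam P (vball dd (z : V) (8 * L)))

/-- `∑_{x ∈ Ĉ_z} ē_{Ĉ_z}(x) ℓ_x`. -/
def locAvg (lam dd : V → V → ℝ) (P : V → Measure (ℕ → V)) (L : ℝ) (z : V)
    {Ω : Type} (ℓx : V → Ω → ℝ) (ω : Ω) : ℝ :=
  ∑' x : vball dd z (8 * L),
    (equi lam P (vball dd z (8 * L)) x / capa lam P (vball dd z (8 * L))) * ℓx x ω

/-- Analytic properties of the Green function of a random walk that are used below: `p` are the
transition probabilities, `N x` the neighbours of `x`, `m` the reversible measure, `Bl` the balls. -/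
structure IsGreenKernel {X : Type*} (dd p g : X → X → ℝ) (N : X → Finset X) (m : X → ℝ)
    (Bl : X → ℝ → Finset X) (α ν c₁ C₁ c₂ C₂ J : ℝ) : Prop where
  p_pos : ∀ x, ∀ y ∈ N x, 0 < p x y
  p_sum : ∀ x, ∑ y ∈ N x, p x y = 1
  m_pos : ∀ x, 0 < m x
  g_eq : ∀ x y, g x y = (if x = y then (m y)⁻¹ else 0) + ∑ w ∈ N x, p x w * g w y
  irred : ∀ M : Set X, (∀ x ∈ M, ∀ y ∈ N x, y ∈ M) → ∀ x ∈ M, ∀ y, y ∈ M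
  dd_self : ∀ x, dd x x = 0
  dd_pos : ∀ x y, x ≠ y → 0 < dd x y
  dd_symm : ∀ x y, dd x y = dd y x
  dd_triangle : ∀ x y z, dd x z ≤ dd x y + dd y z
  mem_ball : ∀ x r y, y ∈ Bl x r ↔ dd x y ≤ r
  vol_lower : ∀ x r, 1 ≤ r → c₁ * r ^ α ≤ ∑ y ∈ Bl x r, m y
  vol_upper : ∀ x r, 1 ≤ r → ∑ y ∈ Bl x r, m y ≤ C₁ * r ^ α
  g_diag_lower : ∀ x, c₂ ≤ g x x
  g_diag_upper : ∀ x, g x x ≤ C₂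
  g_lower : ∀ x y, x ≠ y → c₂ * dd x y ^ (-ν) ≤ g x y
  g_upper : ∀ x y, x ≠ y → g x y ≤ C₂ * dd x y ^ (-ν)
  c₁_pos : 0 < c₁
  c₂_pos : 0 < c₂
  nu_pos : 0 < ν
  nu_le : ν ≤ α - 2
  J_pos : 0 < J
  jump : ∀ x, ∀ y ∈ N x, dd x y ≤ J

namespace IsGreenKernel

variable {X : Type*} {dd p g : X → X → ℝ} {N : X → Finset X} {m : X → ℝ}
  {Bl : X → ℝ → Finset X} {α ν c₁ C₁ c₂ C₂ J : ℝ}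

lemma exists_notMem (h : IsGreenKernel dd p g N m Bl α ν c₁ C₁ c₂ C₂ J) (W : Finset X) (x : X) :
    ∃ y, y ∉ W := by
  by_contra! hW
  have hα : 0 < α := by linarith [h.nu_pos, h.nu_le]
  have ht : Tendsto (fun r : ℝ => c₁ * r ^ α) atTop atTop :=
    (tendsto_rpow_atTop hα).const_mul_atTop h.c₁_pos
  obtain ⟨r, hr, hr1⟩ := ((ht.eventually_gt_atTop (∑ y ∈ W, m y)).and
    (eventually_ge_atTop 1)).exists
  have := h.vol_lower x r hr1
  have h2 : ∑ y ∈ Bl x r, m y ≤ ∑ y ∈ W, m y :=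
    Finset.sum_le_sum_of_subset_of_nonneg (fun y _ => hW y) (fun y _ _ => (h.m_pos y).le)
  linarith

/-- Minimum principle for superharmonic functions on a finite set. -/
lemma nonneg_of_superharmonic (h : IsGreenKernel dd p g N m Bl α ν c₁ C₁ c₂ C₂ J) (W : Finset X)
    (F : X → ℝ) (hF : ∀ x ∈ W, ∑ y ∈ N x, p x y * F y ≤ F x)
    (hb : ∀ x ∈ W, ∀ y ∈ N x, y ∉ W → 0 ≤ F y) (x : X) (hx : x ∈ W) : 0 ≤ F x := by
  by_contra! hneg
  obtain ⟨x₀, hx₀, hmin⟩ := W.exists_min_image F ⟨x, hx⟩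
  have hx₀neg : F x₀ < 0 := (hmin x hx).trans_lt hneg
  obtain ⟨y₀, hy₀⟩ := h.exists_notMem W x
  refine hy₀ (h.irred {x | x ∈ W ∧ F x = F x₀} ?_ x₀ ⟨hx₀, rfl⟩ y₀).1
  rintro a ⟨ha, hFa⟩ y hy
  have hge : ∀ y ∈ N a, F x₀ ≤ F y := fun y hy => by
    by_cases hyW : y ∈ W
    · exact hmin y hyW
    · exact hx₀neg.le.trans (hb a ha y hy hyW)
  have hsum : ∑ y ∈ N a, p a y * (F y - F x₀) ≤ 0 := by
    simp only [mul_sub, Finset.sum_sub_distrib, ← Finset.sum_mul, h.p_sum]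
    linarith [hF a ha]
  have hz := (Finset.sum_eq_zero_iff_of_nonneg (fun y hy =>
    mul_nonneg (h.p_pos a y hy).le (sub_nonneg.2 (hge y hy)))).1
    (le_antisymm hsum (Finset.sum_nonneg fun y hy =>
      mul_nonneg (h.p_pos a y hy).le (sub_nonneg.2 (hge y hy)))) y hy
  have hFy : F y = F x₀ := by
    rcases mul_eq_zero.1 hz with h0 | h0
    · exact absurd h0 (h.p_pos a y hy).ne'
    · linarith
  refine ⟨?_, hFy⟩
  by_contra hyW
  linarith [hb a ha y hy hyW]

lemma g_pos (h : IsGreenKernel dd p g N m Bl α ν c₁ C₁ c₂ C₂ J) (x y : X) : 0 < g x y := by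
  by_cases hxy : x = y
  · exact hxy ▸ h.c₂_pos.trans_le (h.g_diag_lower x)
  · exact (mul_pos h.c₂_pos (Real.rpow_pos_of_pos (h.dd_pos x y hxy) _)).trans_le
      (h.g_lower x y hxy)

lemma C₂_pos (h : IsGreenKernel dd p g N m Bl α ν c₁ C₁ c₂ C₂ J) (x : X) : 0 < C₂ :=
  (h.c₂_pos.trans_le (h.g_diag_lower x)).trans_le (h.g_diag_upper x)

lemma C₁_pos (h : IsGreenKernel dd p g N m Bl α ν c₁ C₁ c₂ C₂ J) (x : X) : 0 < C₁ := by
  have h1 := (h.vol_lower x 1 le_rfl).trans (h.vol_upper x 1 le_rfl)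
  simp only [Real.one_rpow, mul_one] at h1
  exact h.c₁_pos.trans_le h1

lemma dd_nonneg (h : IsGreenKernel dd p g N m Bl α ν c₁ C₁ c₂ C₂ J) (x y : X) : 0 ≤ dd x y := by
  by_cases hxy : x = y
  · rw [hxy, h.dd_self]
  · exact (h.dd_pos x y hxy).le

lemma g_le_of_le (h : IsGreenKernel dd p g N m Bl α ν c₁ C₁ c₂ C₂ J) {x y : X} {r : ℝ}
    (hr : 0 < r) (hxy : r ≤ dd x y) : g x y ≤ C₂ * r ^ (-ν) := by
  have hne : x ≠ y := by
    rintro rfl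
    rw [h.dd_self] at hxy
    linarith
  exact (h.g_upper x y hne).trans (mul_le_mul_of_nonneg_left
    (Real.rpow_le_rpow_of_nonpos hr hxy (by linarith [h.nu_pos])) (h.C₂_pos x).le)

lemma le_g_of_le (h : IsGreenKernel dd p g N m Bl α ν c₁ C₁ c₂ C₂ J) {x y : X} {r : ℝ}
    (hr : 1 ≤ r) (hxy : dd x y ≤ r) : c₂ * r ^ (-ν) ≤ g x y := by
  by_cases hne : x = y
  · subst hne
    refine le_trans ?_ (h.g_diag_lower x)
    exact mul_le_of_le_one_right h.c₂_pos.le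
      (Real.rpow_le_one_of_one_le_of_nonpos hr (by linarith [h.nu_pos]))
  · exact (mul_le_mul_of_nonneg_left (Real.rpow_le_rpow_of_nonpos (h.dd_pos x y hne) hxy
      (by linarith [h.nu_pos])) h.c₂_pos.le).trans (h.g_lower x y hne)

lemma g_harmonic (h : IsGreenKernel dd p g N m Bl α ν c₁ C₁ c₂ C₂ J) {x y : X} (hxy : x ≠ y) :
    ∑ w ∈ N x, p x w * g w y = g x y := by
  rw [h.g_eq x y, if_neg hxy, zero_add]

lemma potential_harmonic (h : IsGreenKernel dd p g N m Bl α ν c₁ C₁ c₂ C₂ J) {S : Finset X}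
    (f : X → ℝ) {x : X} (hx : x ∉ S) :
    ∑ w ∈ N x, p x w * ∑ y ∈ S, g w y * f y = ∑ y ∈ S, g x y * f y := by
  simp only [Finset.mul_sum]
  rw [Finset.sum_comm]
  refine Finset.sum_congr rfl fun y hy => ?_
  rw [← h.g_harmonic (x := x) (y := y) (by rintro rfl; exact hx hy), Finset.sum_mul]
  exact Finset.sum_congr rfl fun w _ => by ring

/-- A potential is dominated by its supremum over the support of the charge. -/
lemma potential_le (h : IsGreenKernel dd p g N m Bl α ν c₁ C₁ c₂ C₂ J) (S : Finset X)
    (f : X → ℝ) (hf : ∀ y ∈ S, 0 ≤ f y) {M : ℝ} (hM : 0 < M)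
    (hS : ∀ x ∈ S, ∑ y ∈ S, g x y * f y ≤ M) (x : X) : ∑ y ∈ S, g x y * f y ≤ M := by
  by_cases hxS : x ∈ S
  · exact hS x hxS
  set T : ℝ := ∑ y ∈ S, f y with hT
  have hT0 : 0 ≤ T := Finset.sum_nonneg hf
  have hlim : Tendsto (fun r : ℝ => C₂ * r ^ (-ν) * T) atTop (𝓝 0) := by
    simpa using ((tendsto_rpow_neg_atTop h.nu_pos).const_mul C₂).mul_const T
  obtain ⟨r, hr, hr0⟩ := ((hlim.eventually_lt_const hM).and (eventually_gt_atTop 0)).exists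
  set R : ℝ := r + ∑ y ∈ S, dd x y with hR
  have hdd : ∀ y ∈ S, dd x y ≤ ∑ y ∈ S, dd x y := fun y hy =>
    Finset.single_le_sum (fun z _ => h.dd_nonneg x z) hy
  have key := h.nonneg_of_superharmonic (Bl x R \ S) (fun z => M - ∑ y ∈ S, g z y * f y) ?_ ?_ x ?_
  · simpa using key
  · intro z hz
    simp only [mul_sub, Finset.sum_sub_distrib, ← Finset.sum_mul, h.p_sum]
    rw [h.potential_harmonic f (Finset.mem_sdiff.1 hz).2]
    linarith
  · intro z _ y _ hy
    rw [sub_nonneg]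
    by_cases hyS : y ∈ S
    · exact hS y hyS
    have hRy : R < dd x y := by
      by_contra! hle
      exact hy (Finset.mem_sdiff.2 ⟨(h.mem_ball _ _ _).2 hle, hyS⟩)
    refine le_trans ?_ hr.le
    rw [hT, Finset.mul_sum]
    refine Finset.sum_le_sum fun w hw => mul_le_mul_of_nonneg_right ?_ (hf w hw)
    refine h.g_le_of_le hr0 ?_
    have := h.dd_triangle x w y
    rw [h.dd_symm y w]
    linarith [hdd w hw]
  · refine Finset.mem_sdiff.2 ⟨(h.mem_ball _ _ _).2 ?_, hxS⟩
    rw [h.dd_self, hR]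
    exact add_nonneg hr0.le (Finset.sum_nonneg fun z _ => h.dd_nonneg x z)

lemma g_le (h : IsGreenKernel dd p g N m Bl α ν c₁ C₁ c₂ C₂ J) (x y : X) : g x y ≤ C₂ := by
  have := h.potential_le {y} (fun _ => 1) (by simp) (h.C₂_pos x)
    (by simpa using h.g_diag_upper y) x
  simpa using this

lemma sum_ball_two_pow_le (h : IsGreenKernel dd p g N m Bl α ν c₁ C₁ c₂ C₂ J) (x : X) (n : ℕ) :
    ∑ y ∈ Bl x (2 ^ n), g x y * m y ≤ C₂ * C₁ * 2 ^ α * ((2 : ℝ) ^ n) ^ (α - ν) := by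
  have hC₁ := h.C₁_pos x
  have hC₂ := h.C₂_pos x
  have hα : 0 < α := by linarith [h.nu_pos, h.nu_le]
  have h2 : (1 : ℝ) ≤ 2 ^ α := Real.one_le_rpow (by norm_num) hα.le
  induction n with
  | zero =>
    simp only [pow_zero, Real.one_rpow, mul_one]
    calc ∑ y ∈ Bl x 1, g x y * m y ≤ ∑ y ∈ Bl x 1, C₂ * m y :=
          Finset.sum_le_sum fun y _ => mul_le_mul_of_nonneg_right (h.g_le x y) (h.m_pos y).le
      _ = C₂ * ∑ y ∈ Bl x 1, m y := by rw [Finset.mul_sum]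
      _ ≤ C₂ * (C₁ * 1 ^ α) := mul_le_mul_of_nonneg_left (h.vol_upper x 1 le_rfl) hC₂.le
      _ ≤ C₂ * C₁ * 2 ^ α := by
        rw [Real.one_rpow, mul_one]
        exact le_mul_of_one_le_right (mul_pos hC₂ hC₁).le h2
  | succ n ih =>
    have hq : (0 : ℝ) < 2 ^ n := by positivity
    have hq1 : (1 : ℝ) ≤ 2 ^ n := one_le_pow₀ (by norm_num)
    have hsub : Bl x (2 ^ n) ⊆ Bl x (2 ^ (n + 1)) := fun y hy => by
      rw [h.mem_ball] at hy ⊢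
      refine hy.trans ?_
      rw [pow_succ]
      linarith
    rw [← Finset.sum_sdiff hsub]
    have h1 : ∑ y ∈ Bl x (2 ^ (n + 1)) \ Bl x (2 ^ n), g x y * m y
        ≤ C₂ * C₁ * 2 ^ α * ((2 : ℝ) ^ n) ^ (α - ν) := by
      calc _ ≤ ∑ y ∈ Bl x (2 ^ (n + 1)) \ Bl x (2 ^ n), C₂ * ((2 : ℝ) ^ n) ^ (-ν) * m y := by
            refine Finset.sum_le_sum fun y hy =>
              mul_le_mul_of_nonneg_right (h.g_le_of_le hq ?_) (h.m_pos y).le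
            rw [Finset.mem_sdiff, h.mem_ball, h.mem_ball] at hy
            linarith [hy.2]
        _ = C₂ * ((2 : ℝ) ^ n) ^ (-ν) * ∑ y ∈ Bl x (2 ^ (n + 1)) \ Bl x (2 ^ n), m y := by
            rw [Finset.mul_sum]
        _ ≤ C₂ * ((2 : ℝ) ^ n) ^ (-ν) * (C₁ * (2 * 2 ^ n) ^ α) := by
            refine mul_le_mul_of_nonneg_left ?_ (by positivity)
            rw [← pow_succ']
            exact (Finset.sum_le_sum_of_subset_of_nonneg Finset.sdiff_subset
              (fun y _ _ => (h.m_pos y).le)).trans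
              (h.vol_upper x _ (one_le_pow₀ (by norm_num)))
        _ = _ := by
            rw [Real.mul_rpow (by norm_num) hq.le, sub_eq_add_neg, Real.rpow_add hq]
            ring
    have h4 : (2 : ℝ) ≤ 2 ^ (α - ν) := by
      calc (2 : ℝ) = 2 ^ (1 : ℝ) := by rw [Real.rpow_one]
        _ ≤ _ := Real.rpow_le_rpow_of_exponent_le (by norm_num) (by linarith [h.nu_le])
    have e : ((2 : ℝ) ^ (n + 1)) ^ (α - ν) = ((2 : ℝ) ^ n) ^ (α - ν) * 2 ^ (α - ν) := by
      rw [pow_succ, Real.mul_rpow hq.le (by norm_num)]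
    rw [e]
    have hP : 0 ≤ C₂ * C₁ * 2 ^ α * ((2 : ℝ) ^ n) ^ (α - ν) := by positivity
    nlinarith [mul_le_mul_of_nonneg_left h4 hP]

lemma sum_ball_le (h : IsGreenKernel dd p g N m Bl α ν c₁ C₁ c₂ C₂ J) (x : X) {r : ℝ}
    (hr : 1 ≤ r) :
    ∑ y ∈ Bl x r, g x y * m y ≤ C₂ * C₁ * 2 ^ α * (2 * r) ^ (α - ν) := by
  have hC₁ := h.C₁_pos x
  have hC₂ := h.C₂_pos x
  obtain ⟨n, hn1, hn2⟩ := exists_nat_pow_near hr (by norm_num : (1 : ℝ) < 2)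
  calc ∑ y ∈ Bl x r, g x y * m y ≤ ∑ y ∈ Bl x (2 ^ (n + 1)), g x y * m y := by
        refine Finset.sum_le_sum_of_subset_of_nonneg (fun y hy => ?_)
          (fun y _ _ => mul_nonneg (h.g_pos x y).le (h.m_pos y).le)
        rw [h.mem_ball] at hy ⊢
        linarith
    _ ≤ _ := h.sum_ball_two_pow_le x (n + 1)
    _ ≤ _ := by
        refine mul_le_mul_of_nonneg_left (Real.rpow_le_rpow (by positivity) ?_
          (by linarith [h.nu_le])) (by positivity)
        rw [pow_succ]
        linarith

/-- A nonnegative harmonic function that is at least `s` on half of a ball is bounded below by a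
fixed multiple of `s` on that ball. -/
lemma exists_lower_bound (h : IsGreenKernel dd p g N m Bl α ν c₁ C₁ c₂ C₂ J) (x₀ : X) :
    ∃ ρ κ : ℝ, 1 < ρ ∧ 0 < κ ∧ κ < 1 ∧ ∀ (z : X) (r s : ℝ) (f : X → ℝ) (D : Finset X),
      1 ≤ r → 0 ≤ s → D ⊆ Bl z r → ∑ y ∈ Bl z r, m y ≤ 2 * ∑ y ∈ D, m y →
      (∀ x ∈ Bl z (ρ * r), ∑ y ∈ N x, p x y * f y = f x) →
      (∀ x ∈ Bl z (ρ * r), 0 ≤ f x) → (∀ x ∈ D, s ≤ f x) → ∀ x ∈ Bl z r, κ * s ≤ f x := by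
  have hC₁ := h.C₁_pos x₀
  have hC₂ := h.C₂_pos x₀
  have hc₁ := h.c₁_pos
  have hc₂ := h.c₂_pos
  have hlim : Tendsto (fun r : ℝ => C₂ * r ^ (-ν)) atTop (𝓝 0) := by
    simpa using ((tendsto_rpow_neg_atTop h.nu_pos).const_mul C₂)
  obtain ⟨σ, hσ, hσ1⟩ := ((hlim.eventually_lt_const
    (by positivity : 0 < c₂ * (2 : ℝ) ^ (-ν) / 2)).and (eventually_ge_atTop 1)).exists
  set A : ℝ := C₂ * C₁ * 2 ^ α * 4 ^ (α - ν) with hA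
  set a : ℝ := c₁ / 2 * (c₂ * (2 : ℝ) ^ (-ν) / 2) with ha
  have hA0 : 0 < A := by positivity
  have ha0 : 0 < a := by positivity
  have hJ := h.J_pos
  refine ⟨σ + 1 + J, min (a / A) (1 / 2), by linarith, lt_min (div_pos ha0 hA0) (by norm_num),
    (min_le_right _ _).trans_lt (by norm_num), ?_⟩
  intro z r s f D hr hs hD hhalf hharm hf0 hfD x hx
  have hr0 : 0 < r := by linarith
  have hrp : (0 : ℝ) < r ^ (α - ν) := by positivity
  set U : ℝ := A * r ^ (α - ν) with hU
  have hU0 : 0 < U := by positivity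
  set c : ℝ := C₂ * (σ * r) ^ (-ν) with hc
  set u : X → ℝ := fun y => ∑ w ∈ D, g y w * m w - c * ∑ w ∈ D, m w with hu
  have hc0 : 0 ≤ c := by positivity
  have hmD : 0 ≤ ∑ w ∈ D, m w := Finset.sum_nonneg fun w _ => (h.m_pos w).le
  have hDz : ∀ w ∈ D, dd z w ≤ r := fun w hw => (h.mem_ball _ _ _).1 (hD hw)
  -- upper bound on `D`
  have huD : ∀ y ∈ D, u y ≤ U := by
    intro y hy
    have h1 : ∑ w ∈ D, g y w * m w ≤ U := by
      calc ∑ w ∈ D, g y w * m w ≤ ∑ w ∈ Bl y (2 * r), g y w * m w := by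
            refine Finset.sum_le_sum_of_subset_of_nonneg (fun w hw => ?_)
              (fun w _ _ => mul_nonneg (h.g_pos y w).le (h.m_pos w).le)
            rw [h.mem_ball]
            have := h.dd_triangle y z w
            rw [h.dd_symm y z] at this
            linarith [hDz y hy, hDz w hw]
        _ ≤ _ := h.sum_ball_le y (by linarith)
        _ = U := by
            rw [hU, hA, show 2 * (2 * r) = 4 * r by ring, Real.mul_rpow (by norm_num) hr0.le]
            ring
    have : 0 ≤ c * ∑ w ∈ D, m w := mul_nonneg hc0 hmD
    simp only [hu]
    linarith
  -- nonpositive outside the large ball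
  have huout : ∀ y, (σ + 1) * r < dd z y → u y ≤ 0 := by
    intro y hy
    simp only [hu, sub_nonpos, Finset.mul_sum]
    refine Finset.sum_le_sum fun w hw =>
      mul_le_mul_of_nonneg_right (h.g_le_of_le (by positivity) ?_) (h.m_pos w).le
    have := h.dd_triangle z w y
    rw [h.dd_symm y w]
    linarith [hDz w hw]
  -- lower bound on the ball
  have hulow : ∀ y ∈ Bl z r, a * r ^ (α - ν) ≤ u y := by
    intro y hy
    have hy' := (h.mem_ball _ _ _).1 hy
    have h1 : c₂ * (2 * r) ^ (-ν) * ∑ w ∈ D, m w ≤ ∑ w ∈ D, g y w * m w := by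
      rw [Finset.mul_sum]
      refine Finset.sum_le_sum fun w hw =>
        mul_le_mul_of_nonneg_right (h.le_g_of_le (by linarith) ?_) (h.m_pos w).le
      have := h.dd_triangle y z w
      rw [h.dd_symm y z] at this
      linarith [hDz w hw]
    have h2 : c ≤ c₂ * (2 * r) ^ (-ν) / 2 := by
      rw [hc, Real.mul_rpow (by linarith) hr0.le, Real.mul_rpow (by norm_num) hr0.le]
      have : 0 < r ^ (-ν) := by positivity
      nlinarith
    have h3 : c₁ / 2 * r ^ α ≤ ∑ w ∈ D, m w := by linarith [h.vol_lower z r hr]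
    have h4 : c₂ * (2 * r) ^ (-ν) / 2 * (c₁ / 2 * r ^ α) ≤ u y := by
      have := mul_le_mul_of_nonneg_left h3
        (by positivity : 0 ≤ c₂ * (2 * r) ^ (-ν) / 2)
      have h5 := mul_le_mul_of_nonneg_right h2 hmD
      simp only [hu]
      linarith
    refine le_trans (le_of_eq ?_) h4
    rw [ha, Real.mul_rpow (by norm_num) hr0.le, sub_eq_add_neg, Real.rpow_add hr0]
    ring
  have huharm : ∀ y ∉ D, ∑ w ∈ N y, p y w * u w = u y := by
    intro y hy
    simp only [hu, mul_sub, Finset.sum_sub_distrib, h.potential_harmonic m hy]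
    rw [← Finset.sum_mul, h.p_sum, one_mul]
  have hfin : s / U * u x ≤ f x := by
    by_cases hxD : x ∈ D
    · refine le_trans ?_ (hfD x hxD)
      rw [div_mul_eq_mul_div, div_le_iff₀ hU0]
      exact mul_le_mul_of_nonneg_left (huD x hxD) hs
    have key := h.nonneg_of_superharmonic (Bl z ((σ + 1) * r) \ D)
      (fun y => f y - s / U * u y) ?_ ?_ x ?_
    · simpa using key
    · intro y hy
      rw [Finset.mem_sdiff, h.mem_ball] at hy
      have e1 : ∑ w ∈ N y, p y w * (f w - s / U * u w)
          = ∑ w ∈ N y, p y w * f w - s / U * ∑ w ∈ N y, p y w * u w := by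
        rw [Finset.mul_sum, ← Finset.sum_sub_distrib]
        exact Finset.sum_congr rfl fun w _ => by ring
      rw [e1, huharm y hy.2, hharm y]
      rw [h.mem_ball]
      nlinarith [hy.1]
    · intro y hy w hw hwn
      rw [Finset.mem_sdiff, h.mem_ball] at hy
      rw [sub_nonneg]
      by_cases hwD : w ∈ D
      · refine le_trans ?_ (hfD w hwD)
        rw [div_mul_eq_mul_div, div_le_iff₀ hU0]
        exact mul_le_mul_of_nonneg_left (huD w hwD) hs
      · have hwout : (σ + 1) * r < dd z w := by
          by_contra! hle
          exact hwn (Finset.mem_sdiff.2 ⟨(h.mem_ball _ _ _).2 hle, hwD⟩)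
        refine le_trans (mul_nonpos_of_nonneg_of_nonpos (div_nonneg hs hU0.le)
          (huout w hwout)) (hf0 w ?_)
        rw [h.mem_ball]
        have := h.dd_triangle z y w
        nlinarith [h.jump y w hw, hy.1]
    · rw [h.mem_ball] at hx
      refine Finset.mem_sdiff.2 ⟨(h.mem_ball _ _ _).2 ?_, hxD⟩
      nlinarith
  refine le_trans ?_ hfin
  have h1 := hulow x hx
  calc min (a / A) (1 / 2) * s ≤ a / A * s := mul_le_mul_of_nonneg_right (min_le_left _ _) hs
    _ = s / U * (a * r ^ (α - ν)) := by
        rw [hU]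
        field_simp
    _ ≤ s / U * u x := mul_le_mul_of_nonneg_left h1 (div_nonneg hs hU0.le)

/-- The oscillation of a harmonic function decreases geometrically in the scale. -/
lemma exists_osc_decay (h : IsGreenKernel dd p g N m Bl α ν c₁ C₁ c₂ C₂ J) (x₀ : X) :
    ∃ ρ θ : ℝ, 1 < ρ ∧ 0 < θ ∧ θ < 1 ∧ ∀ (n : ℕ) (z : X) (r a b : ℝ) (f : X → ℝ), 1 ≤ r →
      (∀ x ∈ Bl z (ρ ^ n * r), ∑ y ∈ N x, p x y * f y = f x) →
      (∀ x ∈ Bl z (ρ ^ n * r), a ≤ f x ∧ f x ≤ b) →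
      ∀ x ∈ Bl z r, ∀ y ∈ Bl z r, f x - f y ≤ θ ^ n * (b - a) := by
  obtain ⟨ρ, κ, hρ, hκ, hκ1, H⟩ := h.exists_lower_bound x₀
  refine ⟨ρ, 1 - κ / 2, hρ, by linarith, by linarith, fun n => ?_⟩
  induction n with
  | zero =>
    intro z r a b f hr _ hab x hx y hy
    simp only [pow_zero, one_mul] at hab ⊢
    linarith [(hab x hx).2, (hab y hy).1]
  | succ n ih =>
    intro z r a b f hr hharm hab
    set r' : ℝ := ρ ^ n * r with hr'
    have hr'1 : 1 ≤ r' := one_le_mul_of_one_le_of_one_le (one_le_pow₀ hρ.le) hr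
    have e : ρ ^ (n + 1) * r = ρ * r' := by rw [hr']; ring
    rw [e] at hharm hab
    have hsub : Bl z r' ⊆ Bl z (ρ * r') := fun x hx => by
      rw [h.mem_ball] at hx ⊢
      nlinarith
    have hharm' : ∀ x ∈ Bl z r', ∑ y ∈ N x, p x y * f y = f x := fun x hx => hharm x (hsub hx)
    have hz : z ∈ Bl z r' := by
      rw [h.mem_ball, h.dd_self]
      linarith
    have hba : a ≤ b := (hab z (hsub hz)).1.trans (hab z (hsub hz)).2
    set D := (Bl z r').filter (fun x => (a + b) / 2 ≤ f x) with hD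
    set D' := (Bl z r').filter (fun x => ¬ (a + b) / 2 ≤ f x) with hD'
    have hsplit : ∑ x ∈ D, m x + ∑ x ∈ D', m x = ∑ x ∈ Bl z r', m x :=
      Finset.sum_filter_add_sum_filter_not _ _ _
    have hsc : ∀ x, ∀ c : ℝ, ∑ y ∈ N x, p x y * (f y - c) = ∑ y ∈ N x, p x y * f y - c := by
      intro x c
      simp only [mul_sub, Finset.sum_sub_distrib, ← Finset.sum_mul, h.p_sum, one_mul]
    intro x hx y hy
    rcases le_total (∑ x ∈ D', m x) (∑ x ∈ D, m x) with hle | hle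
    · have key := H z r' ((b - a) / 2) (fun x => f x - a) D hr'1 (by linarith)
        (Finset.filter_subset _ _) (by linarith) (fun x hx => by rw [hsc, hharm x hx])
        (fun x hx => by linarith [(hab x hx).1])
        (fun x hx => by linarith [(Finset.mem_filter.1 hx).2])
      have := ih z r (a + κ * ((b - a) / 2)) b f hr hharm'
        (fun x hx => ⟨by linarith [key x hx], (hab x (hsub hx)).2⟩) x hx y hy
      refine this.trans (le_of_eq ?_)
      ring
    · have key := H z r' ((b - a) / 2) (fun x => b - f x) D' hr'1 (by linarith)
        (Finset.filter_subset _ _) (by linarith)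
        (fun x hx => by
          have := hsc x b
          have e2 : ∑ y ∈ N x, p x y * (b - f y) = - ∑ y ∈ N x, p x y * (f y - b) := by
            rw [← Finset.sum_neg_distrib]
            exact Finset.sum_congr rfl fun w _ => by ring
          rw [e2, this, hharm x hx]
          ring)
        (fun x hx => by linarith [(hab x hx).2])
        (fun x hx => by linarith [not_le.1 (Finset.mem_filter.1 hx).2])
      have := ih z r a (b - κ * ((b - a) / 2)) f hr hharm'
        (fun x hx => ⟨(hab x (hsub hx)).1, by linarith [key x hx]⟩) x hx y hy
      refine this.trans (le_of_eq ?_)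
      ring

/-- Far from its pole, the Green function is nearly constant on balls. -/
lemma exists_g_le_mul (h : IsGreenKernel dd p g N m Bl α ν c₁ C₁ c₂ C₂ J) (x₀ : X) {δ : ℝ}
    (hδ : 0 < δ) : ∃ K₀ : ℝ, 1 < K₀ ∧ ∀ (z x : X) (r : ℝ), 1 ≤ r → K₀ * r ≤ dd z x →
      ∀ y ∈ Bl z r, ∀ y' ∈ Bl z r, g y x ≤ (1 + δ) * g y' x := by
  obtain ⟨ρ, θ, hρ, hθ, hθ1, H⟩ := h.exists_osc_decay x₀
  have hC₂ := h.C₂_pos x₀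
  have hc₂ := h.c₂_pos
  set Q : ℝ := C₂ * (2 : ℝ)⁻¹ ^ (-ν) / (c₂ * 2 ^ (-ν)) with hQ
  have hQ0 : 0 < Q := by positivity
  obtain ⟨n, hn⟩ := exists_pow_lt_of_lt_one (div_pos hδ hQ0) hθ1
  have hρn : 1 ≤ ρ ^ n := one_le_pow₀ hρ.le
  refine ⟨2 * ρ ^ n, by linarith, fun z x r hr hK y hy y' hy' => ?_⟩
  set d := dd z x with hd
  have hd1 : 1 ≤ d := by nlinarith
  have hd0 : 0 < d := by linarith
  have hball : ∀ w ∈ Bl z (ρ ^ n * r), d / 2 ≤ dd w x := fun w hw => by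
    rw [h.mem_ball] at hw
    linarith [h.dd_triangle z w x]
  have key := H n z r 0 (C₂ * (d / 2) ^ (-ν)) (fun w => g w x) hr
    (fun w hw => h.g_harmonic (by
      rintro rfl
      have := hball w hw
      rw [h.dd_self] at this
      linarith))
    (fun w hw => ⟨(h.g_pos w x).le, h.g_le_of_le (by linarith) (hball w hw)⟩) y hy y' hy'
  have hlow : c₂ * (2 * d) ^ (-ν) ≤ g y' x := by
    refine h.le_g_of_le (by linarith) ?_
    have h1 := h.dd_triangle y' z x
    rw [h.dd_symm y' z] at h1
    have h2 := (h.mem_ball _ _ _).1 hy'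
    nlinarith
  have hup : C₂ * (d / 2) ^ (-ν) ≤ Q * g y' x := by
    refine le_trans (le_of_eq ?_) (mul_le_mul_of_nonneg_left hlow hQ0.le)
    rw [hQ, Real.mul_rpow (by norm_num) hd0.le, div_eq_inv_mul,
      Real.mul_rpow (by norm_num) hd0.le]
    field_simp
  have hθn : θ ^ n * Q ≤ δ := by
    rw [lt_div_iff₀ hQ0] at hn
    exact hn.le
  have h3 : θ ^ n * (C₂ * (d / 2) ^ (-ν) - 0) ≤ δ * g y' x := by
    rw [sub_zero]
    calc _ ≤ θ ^ n * (Q * g y' x) := mul_le_mul_of_nonneg_left hup (by positivity)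
      _ = θ ^ n * Q * g y' x := by ring
      _ ≤ _ := mul_le_mul_of_nonneg_right hθn (h.g_pos y' x).le
  linarith

end IsGreenKernel

/-- Comparison of the potential of a measure `e` with that of the measure obtained by
redistributing the mass of each piece `C z` according to a probability `f z` whose potential is
constant on `C z`. -/
lemma sum_potential_le {X ι : Type*} (g : X → X → ℝ) (hg : ∀ x y, 0 ≤ g x y)
    (hsymm : ∀ x y, g x y = g y x) (Z : Finset ι) (C : ι → Finset X)
    (hdisj : ∀ z ∈ Z, ∀ z' ∈ Z, z ≠ z' → Disjoint (C z) (C z')) (e : X → ℝ)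
    (he : ∀ x, 0 ≤ e x) (hGe : ∀ x ∈ Z.biUnion C, ∑ y ∈ Z.biUnion C, g x y * e y = 1)
    (f : ι → X → ℝ) (κ : ι → ℝ) (hf : ∀ z x, 0 ≤ f z x)
    (hf1 : ∀ z ∈ Z, ∑ x ∈ C z, f z x = 1)
    (hGf : ∀ z ∈ Z, ∀ x ∈ C z, ∑ y ∈ C z, g x y * f z y = κ z) {δ : ℝ} (hδ : 0 ≤ δ)
    (hfar : ∀ z ∈ Z, ∀ z' ∈ Z, z ≠ z' → ∀ x ∈ C z, ∀ w ∈ C z, ∀ y ∈ C z', ∀ y' ∈ C z',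
      g x y ≤ (1 + δ) * g w y') (x : X) (hx : x ∈ Z.biUnion C) :
    ∑ z ∈ Z, (∑ w ∈ C z, e w) * ∑ y ∈ C z, g x y * f z y ≤ 1 + δ := by
  obtain ⟨z₀, hz₀, hxz₀⟩ := Finset.mem_biUnion.1 hx
  have hpd : Set.PairwiseDisjoint (Z : Set ι) C := fun z hz z' hz' hne => hdisj z hz z' hz' hne
  set T : ι → ℝ := fun z => ∑ w ∈ C z₀, f z₀ w * ∑ y ∈ C z, g w y * e y with hT
  have hT0 : ∀ z, 0 ≤ T z := fun z => Finset.sum_nonneg fun w _ =>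
    mul_nonneg (hf _ _) (Finset.sum_nonneg fun y _ => mul_nonneg (hg _ _) (he _))
  have hTsum : ∑ z ∈ Z, T z = 1 := by
    simp only [hT]
    rw [Finset.sum_comm]
    simp only [← Finset.mul_sum]
    rw [← hf1 z₀ hz₀]
    refine Finset.sum_congr rfl fun w hw => ?_
    rw [← Finset.sum_biUnion hpd, hGe w (Finset.mem_biUnion.2 ⟨z₀, hz₀, hw⟩), mul_one]
  have hdiag : (∑ w ∈ C z₀, e w) * ∑ y ∈ C z₀, g x y * f z₀ y = T z₀ := by
    rw [hGf z₀ hz₀ x hxz₀]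
    simp only [hT, Finset.mul_sum]
    rw [Finset.sum_comm, Finset.sum_mul]
    refine Finset.sum_congr rfl fun y hy => ?_
    rw [← hGf z₀ hz₀ y hy, Finset.mul_sum]
    exact Finset.sum_congr rfl fun w _ => by rw [hsymm w y]; ring
  have hoff : ∀ z ∈ Z, z ≠ z₀ →
      (∑ w ∈ C z, e w) * ∑ y ∈ C z, g x y * f z y ≤ (1 + δ) * T z := by
    intro z hz hne
    have h1 : ∀ w ∈ C z₀, (∑ y ∈ C z, e y) * ∑ y ∈ C z, g x y * f z y
        ≤ (1 + δ) * ∑ y ∈ C z, g w y * e y := by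
      intro w hw
      rw [Finset.sum_mul, Finset.mul_sum _ _ (1 + δ)]
      refine Finset.sum_le_sum fun y hy => ?_
      have h2 : ∑ y' ∈ C z, g x y' * f z y' ≤ (1 + δ) * g w y := by
        calc _ ≤ ∑ y' ∈ C z, (1 + δ) * g w y * f z y' :=
              Finset.sum_le_sum fun y' hy' => mul_le_mul_of_nonneg_right
                (hfar z₀ hz₀ z hz hne.symm x hxz₀ w hw y' hy' y hy) (hf _ _)
          _ = _ := by rw [← Finset.mul_sum, hf1 z hz, mul_one]
      calc _ ≤ e y * ((1 + δ) * g w y) := mul_le_mul_of_nonneg_left h2 (he y)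
        _ = _ := by ring
    calc (∑ w ∈ C z, e w) * ∑ y ∈ C z, g x y * f z y
        = ∑ w ∈ C z₀, f z₀ w * ((∑ w ∈ C z, e w) * ∑ y ∈ C z, g x y * f z y) := by
          rw [← Finset.sum_mul, hf1 z₀ hz₀, one_mul]
      _ ≤ ∑ w ∈ C z₀, f z₀ w * ((1 + δ) * ∑ y ∈ C z, g w y * e y) :=
          Finset.sum_le_sum fun w hw => mul_le_mul_of_nonneg_left (h1 w hw) (hf _ _)
      _ = (1 + δ) * T z := by
          simp only [hT]
          rw [Finset.mul_sum]
          exact Finset.sum_congr rfl fun w _ => by ring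
  calc _ ≤ ∑ z ∈ Z, (1 + δ) * T z := by
        refine Finset.sum_le_sum fun z hz => ?_
        by_cases hzz : z = z₀
        · subst hzz
          rw [hdiag]
          nlinarith [hT0 z]
        · exact hoff z hz hzz
    _ = 1 + δ := by rw [← Finset.mul_sum, hTsum, mul_one]

/-- Moments of a positive semidefinite matrix are moments of a positive measure on `[0, ∞)`. -/
lemma exists_spectral_weights {n : Type*} [Fintype n] [DecidableEq n] (B : Matrix n n ℝ)
    (hB : B.PosSemidef) (h : n → ℝ) :
    ∃ w μ : n → ℝ, (∀ i, 0 ≤ w i) ∧ (∀ i, 0 ≤ μ i) ∧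
      ∀ k : ℕ, h ⬝ᵥ ((B ^ k).mulVec h) = ∑ i, w i * μ i ^ k := by
  set b := hB.1.eigenvectorBasis with hb
  set μ := hB.1.eigenvalues with hμ
  set h' : EuclideanSpace ℝ n := WithLp.toLp 2 h with hh'
  refine ⟨fun i => inner ℝ (b i) h' ^ 2, μ, fun i => sq_nonneg _, hB.eigenvalues_nonneg,
    fun k => ?_⟩
  have hpow : ∀ i, (B ^ k).mulVec (b i).ofLp = μ i ^ k • (b i).ofLp := by
    intro i
    induction k with
    | zero => simp
    | succ k ih =>
      rw [pow_succ', ← Matrix.mulVec_mulVec, ih, Matrix.mulVec_smul, hb,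
        hB.1.mulVec_eigenvectorBasis, smul_smul, pow_succ]
  have hexp : h = ∑ i, inner ℝ (b i) h' • (b i).ofLp := by
    have := congrArg WithLp.ofLp (b.sum_repr' h')
    rw [WithLp.ofLp_sum] at this
    simpa [hh'] using this.symm
  have h1 : (B ^ k).mulVec h = ∑ i, (inner ℝ (b i) h' * μ i ^ k) • (b i).ofLp := by
    conv_lhs => rw [hexp]
    rw [Matrix.mulVec_sum]
    refine Finset.sum_congr rfl fun i _ => ?_
    rw [Matrix.mulVec_smul, hpow, smul_smul]
  rw [h1, dotProduct_sum]
  refine Finset.sum_congr rfl fun i _ => ?_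
  have h2 : h ⬝ᵥ (b i).ofLp = inner ℝ (b i) h' := by
    rw [EuclideanSpace.inner_eq_star_dotProduct]
    simp [hh']
  rw [dotProduct_smul, h2, smul_eq_mul]
  ring

/-- Jensen's inequality for the resolvent of a positive measure. -/
lemma resolvent_lower_bound {n : Type*} [Fintype n] (w μ : n → ℝ) (hw : ∀ i, 0 ≤ w i)
    (hμ : ∀ i, 0 ≤ μ i) {c A s : ℝ} (hc : ∑ i, w i = c) (hc0 : 0 < c) (hA0 : 0 ≤ A)
    (hA : ∑ i, w i * μ i ≤ A * c) (hs : 0 ≤ s) :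
    c / (1 + s * A) ≤ ∑ i, w i / (1 + s * μ i) := by
  have hpos : ∀ i, 0 < 1 + s * μ i := fun i => by
    have := mul_nonneg hs (hμ i)
    linarith
  have hcs := Finset.sum_sq_le_sum_mul_sum_of_sq_le_mul Finset.univ (r := w)
    (f := fun i => w i / (1 + s * μ i)) (g := fun i => w i * (1 + s * μ i))
    (fun i _ => div_nonneg (hw i) (hpos i).le) (fun i _ => mul_nonneg (hw i) (hpos i).le)
    (fun i _ => le_of_eq (by field_simp [(hpos i).ne']))
  have h2 : ∑ i, w i * (1 + s * μ i) ≤ c * (1 + s * A) := by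
    have : ∑ i, w i * (1 + s * μ i) = c + s * ∑ i, w i * μ i := by
      rw [← hc, Finset.mul_sum, ← Finset.sum_add_distrib]
      exact Finset.sum_congr rfl fun i _ => by ring
    rw [this]
    nlinarith
  have hsA : 0 < 1 + s * A := by positivity
  rw [hc] at hcs
  have hS : 0 ≤ ∑ i, w i / (1 + s * μ i) :=
    Finset.sum_nonneg fun i _ => div_nonneg (hw i) (hpos i).le
  rw [div_le_iff₀ hsA]
  have := hcs.trans (mul_le_mul_of_nonneg_left h2 hS)
  nlinarith

open ProbabilityTheory in
lemma integrable_exp_of_mgf_pos {Ω : Type*} [MeasurableSpace Ω] {μ : Measure Ω} {X : Ω → ℝ}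
    {t : ℝ} (h : 0 < mgf X μ t) : Integrable (fun ω => Real.exp (t * X ω)) μ := by
  by_contra hn
  rw [mgf, integral_undef hn] at h
  exact lt_irrefl _ h

lemma summable_pow_succ_mul {a : ℕ → ℝ} {A T t : ℝ} (hA : 0 ≤ A) (ha : ∀ n, |a n| ≤ T * A ^ n)
    (ht : |t| * A < 1) : Summable fun n => t ^ (n + 1) * a n := by
  refine Summable.of_norm_bounded (g := fun n => |t| * T * (|t| * A) ^ n)
    ((summable_geometric_of_lt_one (by positivity) ht).mul_left _) fun n => ?_
  rw [Real.norm_eq_abs, abs_mul, abs_pow]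
  calc |t| ^ (n + 1) * |a n| ≤ |t| ^ (n + 1) * (T * A ^ n) :=
        mul_le_mul_of_nonneg_left (ha n) (by positivity)
    _ = _ := by rw [mul_pow, pow_succ]; ring

open ProbabilityTheory in
/-- Nonnegativity of the variance, read off from an expansion of the cumulant generating
function. -/
lemma second_cumulant_nonneg {Ω : Type*} [MeasurableSpace Ω] {μ : Measure Ω}
    [IsProbabilityMeasure μ] {X : Ω → ℝ} {v A T : ℝ} {a : ℕ → ℝ} (hv : 0 < v) (hA : 0 < A)
    (ha : ∀ n, |a n| ≤ T * A ^ n)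
    (hm : ∀ t : ℝ, |t| * A < 1 → mgf X μ t = Real.exp (v * ∑' n, t ^ (n + 1) * a n)) :
    0 ≤ a 1 := by
  have hT : 0 ≤ T := by simpa using (abs_nonneg _).trans (ha 0)
  have key : ∀ t : ℝ, 0 < t → t * A ≤ 1 / 2 → -(2 * t * (T * A ^ 2)) ≤ a 1 := by
    intro t ht htA
    have ht1 : |t| * A < 1 := by rw [abs_of_pos ht]; linarith
    have ht2 : |-t| * A < 1 := by rwa [abs_neg]
    have hs1 := summable_pow_succ_mul hA.le ha ht1
    have hs2 := summable_pow_succ_mul hA.le ha ht2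
    set P := v * ∑' n, t ^ (n + 1) * a n with hP
    set Q := v * ∑' n, (-t) ^ (n + 1) * a n with hQ
    have hi1 := integrable_exp_of_mgf_pos (by rw [hm t ht1]; exact Real.exp_pos _)
    have hi2 := integrable_exp_of_mgf_pos (by rw [hm (-t) ht2]; exact Real.exp_pos _)
    have hPQ : 0 ≤ P + Q := by
      set r := (Q - P) / 2 with hr
      have h1 : (2 : ℝ) ≤ ∫ ω, (Real.exp r * Real.exp (t * X ω)
          + Real.exp (-r) * Real.exp (-t * X ω)) ∂μ := by
        have h0 : ∫ _ : Ω, (2 : ℝ) ∂μ = 2 := by simp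
        rw [← h0]
        refine integral_mono (integrable_const _)
          ((hi1.const_mul _).add (hi2.const_mul _)) fun ω => ?_
        simp only [← Real.exp_add]
        have e : -r + -t * X ω = -(r + t * X ω) := by ring
        rw [e]
        have := Real.one_le_cosh (r + t * X ω)
        rw [Real.cosh_eq] at this
        linarith
      rw [integral_add (hi1.const_mul _) (hi2.const_mul _), integral_const_mul,
        integral_const_mul] at h1
      have e1 : ∫ ω, Real.exp (t * X ω) ∂μ = Real.exp P := hm t ht1
      have e2 : ∫ ω, Real.exp (-t * X ω) ∂μ = Real.exp Q := hm (-t) ht2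
      rw [e1, e2, ← Real.exp_add, ← Real.exp_add] at h1
      have e3 : r + P = (P + Q) / 2 := by rw [hr]; ring
      have e4 : -r + Q = (P + Q) / 2 := by rw [hr]; ring
      rw [e3, e4] at h1
      have h2 : 1 ≤ Real.exp ((P + Q) / 2) := by linarith
      have := Real.one_le_exp_iff.1 h2
      linarith
    have hsum : 0 ≤ ∑' n, (t ^ (n + 1) * a n + (-t) ^ (n + 1) * a n) := by
      rw [hs1.tsum_add hs2]
      rw [hP, hQ, ← mul_add] at hPQ
      exact nonneg_of_mul_nonneg_right hPQ hv
    rw [← (hs1.add hs2).sum_add_tsum_nat_add 2] at hsum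
    have hrest : ∑' n, (t ^ (n + 2 + 1) * a (n + 2) + (-t) ^ (n + 2 + 1) * a (n + 2))
        ≤ 4 * t ^ 3 * (T * A ^ 2) := by
      have hg := (hasSum_geometric_two).mul_left (2 * t ^ 3 * (T * A ^ 2))
      calc _ ≤ ∑' n : ℕ, 2 * t ^ 3 * (T * A ^ 2) * (1 / 2 : ℝ) ^ n := by
            refine Summable.tsum_le_tsum (fun n => ?_)
              ((summable_nat_add_iff 2).2 (hs1.add hs2)) hg.summable
            have hb : ∀ q : ℝ, |q| = t → q ^ (n + 2 + 1) * a (n + 2)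
                ≤ t ^ 3 * (T * A ^ 2) * (1 / 2 : ℝ) ^ n := by
              intro q hq
              calc _ ≤ |q ^ (n + 2 + 1) * a (n + 2)| := le_abs_self _
                _ = t ^ (n + 2 + 1) * |a (n + 2)| := by rw [abs_mul, abs_pow, hq]
                _ ≤ t ^ (n + 2 + 1) * (T * A ^ (n + 2)) :=
                    mul_le_mul_of_nonneg_left (ha _) (by positivity)
                _ = t ^ 3 * (T * A ^ 2) * (t * A) ^ n := by rw [mul_pow]; ring
                _ ≤ _ := mul_le_mul_of_nonneg_left
                    (pow_le_pow_left₀ (by positivity) htA n) (by positivity)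
            have h1 := hb t (abs_of_pos ht)
            have h2 := hb (-t) (by rw [abs_neg, abs_of_pos ht])
            linarith
        _ = 4 * t ^ 3 * (T * A ^ 2) := by rw [hg.tsum_eq]; ring
    simp only [Finset.sum_range_succ, Finset.sum_range_zero] at hsum
    have h2 : 0 ≤ t ^ 2 * (2 * a 1 + 4 * t * (T * A ^ 2)) := by
      refine hsum.trans ((add_le_add_right hrest _).trans (le_of_eq ?_))
      ring
    have := nonneg_of_mul_nonneg_right h2 (by positivity)
    linarith
  by_contra! hneg
  set D := T * A ^ 2 with hD
  have hD0 : 0 ≤ D := by positivity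
  have h1 : 0 < min (1 / (2 * A)) (-a 1 / (4 * (D + 1))) :=
    lt_min (by positivity) (div_pos (by linarith) (by positivity))
  have h2 := key _ h1 (by
    calc _ ≤ 1 / (2 * A) * A := mul_le_mul_of_nonneg_right (min_le_left _ _) hA.le
      _ = 1 / 2 := by field_simp)
  have h3 : min (1 / (2 * A)) (-a 1 / (4 * (D + 1))) * (4 * (D + 1)) ≤ -a 1 := by
    rw [← le_div_iff₀ (by positivity)]
    exact min_le_right _ _
  nlinarith

open ProbabilityTheory in
/-- Exponential Chebyshev bound for the upper tail. -/
lemma upper_tail_bound {Ω : Type*} [MeasurableSpace Ω] {μ : Measure Ω}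
    [IsProbabilityMeasure μ] {X : Ω → ℝ} {u v A c : ℝ} {a : ℕ → ℝ} (hv : 0 < v) (huv : v < u)
    (hA : 0 < A) (ha0 : ∀ n, 0 ≤ a n) (ha : ∀ n, a n ≤ c * A ^ n)
    (hm : ∀ t : ℝ, |t| * A < 1 → mgf X μ t = Real.exp (v * ∑' n, t ^ (n + 1) * a n)) :
    μ {ω | u * c ≤ X ω} ≤ ENNReal.ofReal (Real.exp (-((√u - √v) ^ 2 * c / A))) := by
  have hu : 0 < u := hv.trans huv
  have hsu : 0 < √u := Real.sqrt_pos.2 hu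
  have hsv : 0 < √v := Real.sqrt_pos.2 hv
  have hlt : √v < √u := Real.sqrt_lt_sqrt hv.le huv
  set t : ℝ := (√u - √v) / (√u * A) with ht
  have ht0 : 0 < t := div_pos (by linarith) (by positivity)
  have htA : t * A = 1 - √v / √u := by rw [ht]; field_simp
  have htA1 : t * A < 1 := by
    rw [htA]
    linarith [div_pos hsv hsu]
  have ht1 : |t| * A < 1 := by rwa [abs_of_pos ht0]
  have hpos : 0 < mgf X μ t := by rw [hm t ht1]; exact Real.exp_pos _
  have key := measure_ge_le_exp_mul_mgf (u * c) ht0.le (integrable_exp_of_mgf_pos hpos)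
  have hS : ∑' n, t ^ (n + 1) * a n ≤ t * c / (1 - t * A) := by
    have hg := (hasSum_geometric_of_lt_one (by positivity : 0 ≤ t * A) htA1).mul_left (t * c)
    calc _ ≤ ∑' n, t * c * (t * A) ^ n := by
          refine Summable.tsum_le_tsum (fun n => ?_)
            (summable_pow_succ_mul hA.le (fun n => by rw [abs_of_nonneg (ha0 n)]; exact ha n) ht1)
            hg.summable
          calc _ ≤ t ^ (n + 1) * (c * A ^ n) := mul_le_mul_of_nonneg_left (ha n) (by positivity)
            _ = _ := by rw [mul_pow]; ring
      _ = _ := by rw [hg.tsum_eq]; ring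
  rw [← ofReal_measureReal]
  refine ENNReal.ofReal_le_ofReal (key.trans ?_)
  rw [hm t ht1, ← Real.exp_add, Real.exp_le_exp]
  have h1 := mul_le_mul_of_nonneg_left hS hv.le
  refine (add_le_add_right h1 _).trans (le_of_eq ?_)
  have e1 : 1 - t * A = √v / √u := by rw [htA]; ring
  rw [e1]
  have hq : ∀ p q : ℝ, 0 < p → 0 < q → u = p ^ 2 → v = q ^ 2 → t = (p - q) / (p * A) →
      -t * (u * c) + v * (t * c / (q / p)) = -((p - q) ^ 2 * c / A) := by
    rintro p q hp hq rfl rfl h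
    rw [h]
    field_simp
    ring
  exact hq _ _ hsu hsv (Real.sq_sqrt hu.le).symm (Real.sq_sqrt hv.le).symm ht

open ProbabilityTheory in
/-- Exponential Chebyshev bound for the lower tail of a nonnegative variable. -/
lemma lower_tail_bound {Ω ι : Type*} [Fintype ι] [MeasurableSpace Ω] {μ : Measure Ω}
    [IsProbabilityMeasure μ] {X : Ω → ℝ} (hX : ∀ ω, 0 ≤ X ω) {u v A c : ℝ} {w m : ι → ℝ}
    (hu : 0 < u) (huv : u < v) (hA : 0 < A) (hc : 0 < c) (hw : ∀ i, 0 ≤ w i) (hm0 : ∀ i, 0 ≤ m i)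
    (hc1 : ∑ i, w i = c) (hA1 : ∑ i, w i * m i ≤ A * c)
    (hm : ∀ t : ℝ, |t| * A < 1 →
      mgf X μ t = Real.exp (v * ∑' n : ℕ, t ^ (n + 1) * ∑ i, w i * m i ^ n)) :
    μ {ω | X ω ≤ u * c} ≤ ENNReal.ofReal (Real.exp (-((√v - √u) ^ 2 * c / A))) := by
  have hv : 0 < v := hu.trans huv
  have hsu : 0 < √u := Real.sqrt_pos.2 hu
  have hsv : 0 < √v := Real.sqrt_pos.2 hv
  have hlt : √u < √v := Real.sqrt_lt_sqrt hu.le huv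
  set M : ℝ := 1 + A + ∑ i, m i with hM
  have hmM : ∀ i, m i < M := fun i => by
    have := Finset.single_le_sum (fun j _ => hm0 j) (Finset.mem_univ i)
    linarith
  have hmsum : 0 ≤ ∑ i, m i := Finset.sum_nonneg fun i _ => hm0 i
  have hM0 : 0 < M := by linarith
  have hAM : A < M := by linarith
  have hsmall : ∀ t : ℝ, |t| < 1 / M → |t| * M < 1 := fun t ht => by
    rwa [lt_div_iff₀ hM0] at ht
  have hden : ∀ t : ℝ, t < 1 / M → ∀ i, 0 < 1 - t * m i := by
    intro t ht i
    rw [lt_div_iff₀ hM0] at ht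
    rcases le_total t 0 with h0 | h0
    · nlinarith [hm0 i]
    · nlinarith [hmM i, hm0 i]
  have hpos : ∀ t : ℝ, |t| < 1 / M → 0 < mgf X μ t := fun t ht => by
    rw [hm t (lt_of_le_of_lt (mul_le_mul_of_nonneg_left hAM.le (abs_nonneg t)) (hsmall t ht))]
    exact Real.exp_pos _
  have hXm : AEMeasurable X μ := by
    have h1 : |1 / (2 * M)| < 1 / M := by
      rw [abs_of_pos (by positivity)]
      gcongr
      linarith
    refine aemeasurable_of_integrable_exp_mul (u := 1 / (2 * M)) (v := 0) ?_
      (integrable_exp_of_mgf_pos (hpos _ h1)) (by simp)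
    positivity
  have hexp : ∀ t : ℝ, t < 1 / M → Integrable (fun ω => Real.exp (t * X ω)) μ := by
    intro t ht
    rcases le_total t 0 with h0 | h0
    · refine Integrable.of_bound (hXm.const_mul t).exp.aestronglyMeasurable 1
        (Eventually.of_forall fun ω => ?_)
      rw [Real.norm_eq_abs, Real.abs_exp]
      exact Real.exp_le_one_iff.2 (mul_nonpos_of_nonpos_of_nonneg h0 (hX ω))
    · exact integrable_exp_of_mgf_pos (hpos t (by rwa [abs_of_nonneg h0]))
  set Φ : ℝ → ℝ := fun t => Real.exp (v * ∑ i, w i * t / (1 - t * m i)) with hΦ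
  have hanal1 : AnalyticOnNhd ℝ (mgf X μ) (Iio (1 / M)) := fun t ht =>
    analyticAt_mgf (mem_interior.2 ⟨Iio (1 / M), fun s hs => hexp s hs, isOpen_Iio, ht⟩)
  have hanal2 : AnalyticOnNhd ℝ Φ (Iio (1 / M)) := fun t ht => by
    refine AnalyticAt.rexp (analyticAt_const.mul (Finset.analyticAt_fun_sum _ fun i _ => ?_))
    exact (analyticAt_const.mul analyticAt_id).div
      (analyticAt_const.sub (analyticAt_id.mul analyticAt_const)) (hden t ht i).ne'
  have heq : mgf X μ =ᶠ[𝓝 0] Φ := by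
    have hnhds : ∀ᶠ t : ℝ in 𝓝 0, |t| < 1 / M := by
      have : Tendsto (fun t : ℝ => |t|) (𝓝 0) (𝓝 0) := by simpa using (continuous_abs.tendsto (0 : ℝ))
      exact this.eventually_lt_const (by positivity)
    filter_upwards [hnhds] with t ht
    have htM := hsmall t ht
    rw [hm t (lt_of_le_of_lt (mul_le_mul_of_nonneg_left hAM.le (abs_nonneg t)) htM), hΦ]
    congr 2
    have hgeo : ∀ i, HasSum (fun n : ℕ => w i * t * (t * m i) ^ n) (w i * t / (1 - t * m i)) := by
      intro i
      rw [div_eq_mul_inv]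
      refine (hasSum_geometric_of_abs_lt_one ?_).mul_left _
      rw [abs_mul, abs_of_nonneg (hm0 i)]
      exact lt_of_le_of_lt (mul_le_mul_of_nonneg_left (hmM i).le (abs_nonneg t)) htM
    have hs := hasSum_sum (s := Finset.univ) fun i _ => hgeo i
    rw [← hs.tsum_eq]
    refine tsum_congr fun n => ?_
    rw [Finset.mul_sum]
    refine Finset.sum_congr rfl fun i _ => ?_
    rw [mul_pow]
    ring
  set s : ℝ := (√v - √u) / (√u * A) with hs
  have hs0 : 0 < s := div_pos (by linarith) (by positivity)
  have hsM : -s < 1 / M := (neg_neg_of_pos hs0).trans (by positivity)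
  have hval : mgf X μ (-s) = Φ (-s) :=
    hanal1.eqOn_of_preconnected_of_eventuallyEq hanal2 (convex_Iio _).isPreconnected
      (z₀ := 0) (mem_Iio.2 (by positivity)) heq hsM
  have key := measure_le_le_exp_mul_mgf (u * c) (neg_nonpos.2 hs0.le) (hexp _ hsM)
  have hres := resolvent_lower_bound w m hw hm0 hc1 hc hA.le hA1 hs0.le
  rw [← ofReal_measureReal]
  refine ENNReal.ofReal_le_ofReal (key.trans ?_)
  rw [hval, hΦ, ← Real.exp_add, Real.exp_le_exp]
  have e0 : ∑ i, w i * -s / (1 - -s * m i) = -(s * ∑ i, w i / (1 + s * m i)) := by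
    rw [Finset.mul_sum, ← Finset.sum_neg_distrib]
    refine Finset.sum_congr rfl fun i _ => ?_
    rw [neg_mul, sub_neg_eq_add]
    ring
  rw [e0, neg_neg]
  have h1 := mul_le_mul_of_nonneg_left (mul_le_mul_of_nonneg_left hres hs0.le) hv.le
  have e1 : 1 + s * A = √v / √u := by rw [hs]; field_simp; ring
  rw [e1] at h1
  have e2 : s * (u * c) - v * (s * (c / (√v / √u))) = -((√v - √u) ^ 2 * c / A) := by
    have hq : ∀ p q : ℝ, 0 < p → 0 < q → u = p ^ 2 → v = q ^ 2 → s = (q - p) / (p * A) →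
        s * (u * c) - v * (s * (c / (q / p))) = -((q - p) ^ 2 * c / A) := by
      rintro p q hp hq rfl rfl h
      rw [h]
      field_simp
      ring
    exact hq _ _ hsu hsv (Real.sq_sqrt hu.le).symm (Real.sq_sqrt hv.le).symm hs
  linarith

lemma GVop_eq_sum {X : Type} {g : X → X → ℝ} {S : Finset X} {f : X → ℝ}
    (hf : ∀ x, x ∉ S → f x = 0) (φ : X → ℝ) (x : X) :
    GVop g f φ x = ∑ y ∈ S, g x y * f y * φ y :=
  tsum_eq_sum fun y hy => by rw [hf y hy, mul_zero, zero_mul]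

lemma GVop_iterate_const_mul {X : Type} (g : X → X → ℝ) (f : X → ℝ) (t : ℝ) (n : ℕ) :
    (GVop g fun x => t * f x)^[n] (fun _ => 1)
      = fun x => t ^ n * (GVop g f)^[n] (fun _ => 1) x := by
  induction n with
  | zero => simp
  | succ n ih =>
    rw [Function.iterate_succ_apply', Function.iterate_succ_apply', ih]
    funext x
    rw [GVop, GVop, ← tsum_mul_left]
    refine tsum_congr fun y => ?_
    rw [pow_succ]
    ring

lemma abs_GVop_iterate_le {X : Type} {g : X → X → ℝ} {S : Finset X} {f : X → ℝ}
    (hf : ∀ x, x ∉ S → f x = 0) {A : ℝ} (hA : ∀ x, ∑ y ∈ S, |g x y * f y| ≤ A) (n : ℕ) (x : X) :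
    |(GVop g f)^[n] (fun _ => 1) x| ≤ A ^ n := by
  have hA0 : 0 ≤ A := (Finset.sum_nonneg fun y _ => abs_nonneg (g x y * f y)).trans (hA x)
  induction n generalizing x with
  | zero => simp
  | succ n ih =>
    rw [Function.iterate_succ_apply', GVop_eq_sum hf]
    calc _ ≤ ∑ y ∈ S, |g x y * f y * (GVop g f)^[n] (fun _ => 1) y| :=
          Finset.abs_sum_le_sum_abs _ _
      _ ≤ ∑ y ∈ S, |g x y * f y| * A ^ n := by
          refine Finset.sum_le_sum fun y _ => ?_
          rw [abs_mul]
          exact mul_le_mul_of_nonneg_left (ih y) (abs_nonneg _)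
      _ ≤ A * A ^ n := by
          rw [← Finset.sum_mul]
          exact mul_le_mul_of_nonneg_right (hA x) (pow_nonneg hA0 n)
      _ = A ^ (n + 1) := (pow_succ' A n).symm

/-- The Laplace identity with Green kernel `g` at level `v` for the field `ℓ`. -/
def LaplaceIdentity {X Ω : Type} [MeasurableSpace Ω] (μ : Measure Ω) (g : X → X → ℝ)
    (v : ℝ) (ℓ : X → Ω → ℝ) : Prop :=
  ∀ f : X → ℝ, (Function.support f).Finite → (∃ r : ℝ, r < 1 ∧ ∀ x, ∑' y, |g x y * f y| ≤ r) →
    ∫ ω, Real.exp (∑' x, f x * ℓ x ω) ∂μ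
      = Real.exp (v * ∑' x, f x * ∑' n : ℕ, (GVop g f)^[n] (fun _ => 1) x)

open ProbabilityTheory in
lemma LaplaceIdentity.mgf_eq {X Ω : Type} [MeasurableSpace Ω] {μ : Measure Ω}
    {g : X → X → ℝ} {v : ℝ} {ℓ : X → Ω → ℝ} (h : LaplaceIdentity μ g v ℓ) {S : Finset X}
    {f : X → ℝ} (hf : ∀ x, x ∉ S → f x = 0) {A : ℝ} (hA : ∀ x, ∑ y ∈ S, |g x y * f y| ≤ A)
    {t : ℝ} (ht : |t| * A < 1) :
    mgf (fun ω => ∑ x ∈ S, f x * ℓ x ω) μ t = Real.exp (v * ∑' n : ℕ, t ^ (n + 1) *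
      ∑ x ∈ S, f x * (GVop g f)^[n] (fun _ => 1) x) := by
  rcases isEmpty_or_nonempty X with hX | ⟨⟨x₀⟩⟩
  · have := h f (Set.toFinite _) ⟨0, one_pos, fun x => hX.elim x⟩
    have hS : S = ∅ := Finset.eq_empty_of_isEmpty S
    subst hS
    simpa [mgf] using this
  have hA0 : 0 ≤ A := (Finset.sum_nonneg fun y _ => abs_nonneg (g x₀ y * f y)).trans (hA x₀)
  have hft : ∀ x, x ∉ S → t * f x = 0 := fun x hx => by rw [hf x hx, mul_zero]
  have key := h (fun x => t * f x)
    (S.finite_toSet.subset fun x hx => by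
      by_contra hxS
      exact hx (hft x hxS))
    ⟨|t| * A, ht, fun x => by
      rw [tsum_eq_sum fun y hy => by rw [hft y hy, mul_zero, abs_zero]]
      refine le_trans (le_of_eq ?_) (mul_le_mul_of_nonneg_left (hA x) (abs_nonneg t))
      rw [Finset.mul_sum]
      refine Finset.sum_congr rfl fun y _ => ?_
      rw [← abs_mul]
      ring_nf⟩
  have e1 : ∀ ω, ∑' x, t * f x * ℓ x ω = t * ∑ x ∈ S, f x * ℓ x ω := fun ω => by
    rw [tsum_eq_sum fun y hy => by rw [hft y hy, zero_mul], Finset.mul_sum]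
    exact Finset.sum_congr rfl fun y _ => mul_assoc _ _ _
  simp only [e1] at key
  rw [mgf, key, tsum_eq_sum (s := S) fun y hy => by rw [hft y hy, zero_mul]]
  congr 2
  have hsum : ∀ x ∈ S, Summable fun n : ℕ =>
      t ^ (n + 1) * (f x * (GVop g f)^[n] (fun _ => 1) x) := fun x _ => by
    refine summable_pow_succ_mul (A := A) (T := |f x|) hA0 (fun n => ?_) ht
    rw [abs_mul]
    exact mul_le_mul_of_nonneg_left (abs_GVop_iterate_le hf hA n x) (abs_nonneg _)
  simp_rw [Finset.mul_sum]
  rw [Summable.tsum_finsetSum hsum]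
  refine Finset.sum_congr rfl fun x _ => ?_
  rw [← tsum_mul_left]
  refine tsum_congr fun n => ?_
  rw [GVop_iterate_const_mul, pow_succ]
  ring

/-- The kernel of a field satisfying the Laplace identity is positive semidefinite. -/
lemma LaplaceIdentity.kernel_nonneg {X Ω : Type} [MeasurableSpace Ω] {μ : Measure Ω}
    [IsProbabilityMeasure μ] {g : X → X → ℝ} {v : ℝ} {ℓ : X → Ω → ℝ}
    (h : LaplaceIdentity μ g v ℓ) (hv : 0 < v) {C : ℝ} (hg : ∀ x y, |g x y| ≤ C)
    (S : Finset X) (f : X → ℝ) :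
    0 ≤ ∑ x ∈ S, ∑ y ∈ S, f x * g x y * f y := by
  set f' : X → ℝ := fun x => if x ∈ S then f x else 0 with hf'
  have hf0 : ∀ x, x ∉ S → f' x = 0 := fun x hx => if_neg hx
  have hff : ∀ x ∈ S, f' x = f x := fun x hx => if_pos hx
  set A : ℝ := 1 + ∑ y ∈ S, |C| * |f' y| with hA
  have hA0 : 0 < A := by
    have : 0 ≤ ∑ y ∈ S, |C| * |f' y| := Finset.sum_nonneg fun y _ => by positivity
    linarith
  have hbd : ∀ x, ∑ y ∈ S, |g x y * f' y| ≤ A := fun x => by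
    have : ∑ y ∈ S, |g x y * f' y| ≤ ∑ y ∈ S, |C| * |f' y| := by
      refine Finset.sum_le_sum fun y _ => ?_
      rw [abs_mul]
      exact mul_le_mul_of_nonneg_right ((hg x y).trans (le_abs_self C)) (abs_nonneg _)
    linarith
  have key := second_cumulant_nonneg (T := ∑ x ∈ S, |f' x|) hv hA0 (fun n => ?_)
    fun t ht => h.mgf_eq hf0 hbd ht
  · refine key.trans (le_of_eq (Finset.sum_congr rfl fun x hx => ?_))
    rw [Function.iterate_one, GVop_eq_sum hf0, Finset.mul_sum]
    refine Finset.sum_congr rfl fun y hy => ?_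
    rw [hff x hx, hff y hy]
    ring
  · rw [Finset.sum_mul]
    refine (Finset.abs_sum_le_sum_abs _ _).trans (Finset.sum_le_sum fun x _ => ?_)
    rw [abs_mul]
    exact mul_le_mul_of_nonneg_left (abs_GVop_iterate_le hf0 hbd n x) (abs_nonneg _)

/-- Spectral representation of the moments of a symmetric positive semidefinite kernel. -/
lemma exists_weights_GVop {X : Type} {g : X → X → ℝ} (hsymm : ∀ x y, g x y = g y x)
    {S : Finset X} (hpsd : ∀ f : X → ℝ, 0 ≤ ∑ x ∈ S, ∑ y ∈ S, f x * g x y * f y) {f : X → ℝ}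
    (hf : ∀ x, 0 ≤ f x) (hfS : ∀ x, x ∉ S → f x = 0) :
    ∃ w m : S → ℝ, (∀ i, 0 ≤ w i) ∧ (∀ i, 0 ≤ m i) ∧
      ∀ n : ℕ, ∑ x ∈ S, f x * (GVop g f)^[n] (fun _ => 1) x = ∑ i, w i * m i ^ n := by
  set B : Matrix S S ℝ := Matrix.of fun x y => √(f x) * g x y * √(f y) with hB
  have hBpsd : B.PosSemidef := by
    refine Matrix.PosSemidef.of_dotProduct_mulVec_nonneg ?_ fun a => ?_
    · ext x y
      simp only [hB, Matrix.conjTranspose_apply, Matrix.of_apply, star_trivial]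
      rw [hsymm]
      ring
    · set a' : X → ℝ := fun x => if hx : x ∈ S then a ⟨x, hx⟩ * √(f x) else 0 with ha'
      have := hpsd a'
      refine this.trans (le_of_eq ?_)
      simp only [star_trivial, dotProduct, Matrix.mulVec]
      rw [← Finset.sum_coe_sort S]
      refine Finset.sum_congr rfl fun x _ => ?_
      rw [← Finset.sum_coe_sort S, Finset.mul_sum]
      refine Finset.sum_congr rfl fun y _ => ?_
      simp only [ha', hB, Matrix.of_apply, x.2, y.2, dif_pos]
      ring
  obtain ⟨w, m, hw, hm, hwm⟩ := exists_spectral_weights B hBpsd fun x : S => √(f x)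
  refine ⟨w, m, hw, hm, fun n => ?_⟩
  rw [← hwm]
  have hit : ∀ x : S, √(f x) * (GVop g f)^[n] (fun _ => 1) x
      = (B ^ n).mulVec (fun x : S => √(f x)) x := by
    induction n with
    | zero => simp
    | succ n ih =>
      intro x
      rw [Function.iterate_succ_apply', GVop_eq_sum hfS, pow_succ', ← Matrix.mulVec_mulVec,
        Matrix.mulVec, dotProduct, ← Finset.sum_coe_sort S, Finset.mul_sum]
      refine Finset.sum_congr rfl fun y _ => ?_
      rw [← ih y, hB, Matrix.of_apply]
      have := Real.mul_self_sqrt (hf y)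
      linear_combination (-√(f x) * g x y * (GVop g f)^[n] (fun _ => 1) ↑y) * this
  rw [← Finset.sum_coe_sort S, dotProduct]
  refine Finset.sum_congr rfl fun x _ => ?_
  rw [← hit x, ← mul_assoc, Real.mul_self_sqrt (hf x)]

/-- Two-sided deviation bounds under the Laplace identity. -/
lemma LaplaceIdentity.tail_bounds {X Ω : Type} [MeasurableSpace Ω] {μ : Measure Ω}
    [IsProbabilityMeasure μ] {g : X → X → ℝ} {v : ℝ} {ℓ : X → Ω → ℝ}
    (h : LaplaceIdentity μ g v ℓ) (hv : 0 < v) (hℓ : ∀ x ω, 0 ≤ ℓ x ω) {C : ℝ}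
    (hg0 : ∀ x y, 0 ≤ g x y) (hg : ∀ x y, g x y ≤ C) (hsymm : ∀ x y, g x y = g y x)
    {S : Finset X} {f : X → ℝ} (hf : ∀ x, 0 ≤ f x) (hfS : ∀ x, x ∉ S → f x = 0) {A c : ℝ}
    (hA : 0 < A) (hbd : ∀ x, ∑ y ∈ S, g x y * f y ≤ A) (hc : 0 < c) (hfc : ∑ x ∈ S, f x = c)
    {u : ℝ} (hu : 0 < u) :
    (u < v → μ {ω | ∑ x ∈ S, f x * ℓ x ω ≤ u * c}
      ≤ ENNReal.ofReal (Real.exp (-((√v - √u) ^ 2 * c / A)))) ∧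
    (v < u → μ {ω | u * c ≤ ∑ x ∈ S, f x * ℓ x ω}
      ≤ ENNReal.ofReal (Real.exp (-((√u - √v) ^ 2 * c / A)))) := by
  have habs : ∀ x, ∑ y ∈ S, |g x y * f y| ≤ A := fun x => by
    refine le_trans (le_of_eq (Finset.sum_congr rfl fun y _ => ?_)) (hbd x)
    exact abs_of_nonneg (mul_nonneg (hg0 x y) (hf y))
  have hmgf := fun (t : ℝ) (ht : |t| * A < 1) => h.mgf_eq hfS habs ht
  have hle : ∀ n, ∑ x ∈ S, f x * (GVop g f)^[n] (fun _ => 1) x ≤ c * A ^ n := fun n => by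
    rw [← hfc, Finset.sum_mul]
    exact Finset.sum_le_sum fun x _ => mul_le_mul_of_nonneg_left
      ((le_abs_self _).trans (abs_GVop_iterate_le hfS habs n x)) (hf x)
  obtain ⟨w, m, hw, hm, hwm⟩ := exists_weights_GVop hsymm
    (h.kernel_nonneg hv (fun x y => by rw [abs_of_nonneg (hg0 x y)]; exact hg x y) S) hf hfS
  constructor
  · intro huv
    refine lower_tail_bound (w := w) (m := m)
      (fun ω => Finset.sum_nonneg fun x _ => mul_nonneg (hf x) (hℓ x ω)) hu huv hA hc hw hm
      ?_ ?_ fun t ht => ?_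
    · have := hwm 0
      simp only [Function.iterate_zero, id, mul_one, pow_zero] at this
      rw [← this, hfc]
    · have := hwm 1
      simp only [pow_one] at this
      rw [← this, mul_comm]
      simpa using hle 1
    · simp_rw [hmgf t ht, hwm]
  · intro hvu
    refine upper_tail_bound hv hvu hA (fun n => ?_) hle hmgf
    rw [hwm]
    exact Finset.sum_nonneg fun i _ => mul_nonneg (hw i) (pow_nonneg (hm i) n)

namespace Standing

variable {V : Type} [MeasurableSpace V] {lam dd : V → V → ℝ} {P : V → Measure (ℕ → V)}
  {α ν c₃ C₃ : ℝ}

/-- The finite set of neighbours of a vertex. -/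
def nbhd (H : Standing lam dd P α ν c₃ C₃) (x : V) : Finset V := (H.locFin x).toFinset

lemma mem_nbhd (H : Standing lam dd P α ν c₃ C₃) {x y : V} : y ∈ H.nbhd x ↔ 0 < lam x y := by
  simp [nbhd]

lemma lam_eq_zero (H : Standing lam dd P α ν c₃ C₃) {x y : V} (h : y ∉ H.nbhd x) :
    lam x y = 0 :=
  le_antisymm (not_lt.1 fun h' => h (H.mem_nbhd.2 h')) (H.lam_nonneg x y)

lemma lamTot_eq_sum (H : Standing lam dd P α ν c₃ C₃) (x : V) :
    lamTot lam x = ∑ y ∈ H.nbhd x, lam x y :=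
  tsum_eq_sum fun _ hy => H.lam_eq_zero hy

lemma lamTot_pos (H : Standing lam dd P α ν c₃ C₃) (x : V) : 0 < lamTot lam x := by
  obtain ⟨c₂, C₂, hc₂, -, hd, -⟩ := H.greenBounds
  refine lt_of_le_of_ne (tsum_nonneg fun y => H.lam_nonneg x y) fun h => ?_
  have := (hd x).1
  rw [green, ← h, inv_zero, zero_mul] at this
  linarith

lemma sum_div_lamTot (H : Standing lam dd P α ν c₃ C₃) (x : V) :
    ∑ y ∈ H.nbhd x, lam x y / lamTot lam x = 1 := by
  rw [← Finset.sum_div, ← H.lamTot_eq_sum, div_self (H.lamTot_pos x).ne']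

lemma exists_nbhd (H : Standing lam dd P α ν c₃ C₃) (x : V) : ∃ y, x ∈ H.nbhd y := by
  by_contra! h
  have : lamTot lam x = 0 := by
    rw [H.lamTot_eq_sum]
    refine Finset.sum_eq_zero fun y _ => ?_
    rw [H.lam_symm]
    exact H.lam_eq_zero (h y)
  exact (H.lamTot_pos x).ne' this

/-- The law of the first step charges single points, so that points are measurable. -/
lemma measurableSingletonClass (H : Standing lam dd P α ν c₃ C₃) :
    MeasurableSingletonClass V := by
  have := H.countable
  refine ⟨fun y' => ?_⟩
  suffices h : measurableAtom y' = {y'} by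
    rw [← h]
    exact MeasurableSet.measurableAtom_of_countable y'
  refine Subset.antisymm (fun y hy => ?_) (singleton_subset_iff.2 (mem_measurableAtom_self y'))
  by_contra hne
  rw [mem_singleton_iff] at hne
  obtain ⟨x, hx⟩ := H.exists_nbhd y
  have := H.prob x
  have hle : P x {ω | ω 1 ∈ measurableAtom y'} ≤ P x {ω | ω 1 = y'} := by
    rw [← measure_toMeasurable {ω : ℕ → V | ω 1 = y'}]
    refine measure_mono fun ω hω => ?_
    have hmeas : MeasurableSet ((fun a => Function.update ω 1 a) ⁻¹'
        toMeasurable (P x) {ω : ℕ → V | ω 1 = y'}) :=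
      (measurable_update ω) (measurableSet_toMeasurable _ _)
    have hsub := measurableAtom_subset hmeas (x := y')
      (subset_toMeasurable _ _ (by simp [Function.update_self]))
    simpa using hsub hω
  have hcov : (univ : Set (ℕ → V)) ⊆ {ω | ω 1 ∈ measurableAtom y'} ∪
      ((⋃ w ∈ ((H.nbhd x).erase y).erase y', {ω | ω 1 = w}) ∪
        ⋃ w ∈ {w | w ∉ H.nbhd x}, {ω | ω 1 = w}) := by
    intro ω _
    by_cases h1 : ω 1 ∈ measurableAtom y'
    · exact Or.inl h1
    · by_cases h2 : ω 1 ∈ H.nbhd x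
      · refine Or.inr (Or.inl ?_)
        simp only [mem_iUnion, mem_ofPred_eq, exists_prop, exists_eq_right', Finset.mem_erase]
        exact ⟨fun h => h1 (h ▸ mem_measurableAtom_self y'), fun h => h1 (h ▸ hy), h2⟩
      · refine Or.inr (Or.inr ?_)
        simpa using h2
  have hnull : P x (⋃ w ∈ {w | w ∉ H.nbhd x}, {ω | ω 1 = w}) = 0 := by
    rw [measure_biUnion_null_iff (Set.to_countable _)]
    intro w hw
    rw [H.step, H.lam_eq_zero hw, zero_div, ENNReal.ofReal_zero]
  have hp0 : ∀ w, 0 ≤ lam x w / lamTot lam x := fun w =>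
    div_nonneg (H.lam_nonneg x w) (H.lamTot_pos x).le
  have h1 : (1 : ℝ≥0∞) ≤ ENNReal.ofReal (lam x y' / lamTot lam x
      + ∑ w ∈ ((H.nbhd x).erase y).erase y', lam x w / lamTot lam x) := by
    rw [ENNReal.ofReal_add (hp0 _) (Finset.sum_nonneg fun w _ => hp0 w),
      ENNReal.ofReal_sum_of_nonneg fun w _ => hp0 w]
    calc (1 : ℝ≥0∞) = P x univ := measure_univ.symm
      _ ≤ _ := measure_mono hcov
      _ ≤ P x {ω | ω 1 ∈ measurableAtom y'} +
          (P x (⋃ w ∈ ((H.nbhd x).erase y).erase y', {ω | ω 1 = w}) + 0) := by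
        refine (measure_union_le _ _).trans (add_le_add_right ?_ _)
        rw [← hnull]
        exact measure_union_le _ _
      _ ≤ _ := by
        rw [add_zero]
        refine add_le_add (hle.trans (H.step x y').le) ((measure_biUnion_finset_le _ _).trans ?_)
        exact Finset.sum_le_sum fun w _ => (H.step x w).le
  rw [← ENNReal.ofReal_one, ENNReal.ofReal_le_ofReal_iff
    (add_nonneg (hp0 _) (Finset.sum_nonneg fun w _ => hp0 w))] at h1
  have h2 := H.sum_div_lamTot x
  rw [← Finset.add_sum_erase _ _ hx] at h2
  have h3 : lam x y' / lamTot lam x + ∑ w ∈ ((H.nbhd x).erase y).erase y', lam x w / lamTot lam x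
      = ∑ w ∈ (H.nbhd x).erase y, lam x w / lamTot lam x := by
    by_cases hy' : y' ∈ (H.nbhd x).erase y
    · exact Finset.add_sum_erase _ (fun w => lam x w / lamTot lam x) hy'
    · rw [Finset.erase_eq_of_notMem hy', H.lam_eq_zero, zero_div, zero_add]
      exact fun h => hy' (Finset.mem_erase.2 ⟨fun e => hne e.symm, h⟩)
  have h4 : 0 < lam x y / lamTot lam x := div_pos (H.mem_nbhd.1 hx) (H.lamTot_pos x)
  linarith

lemma measurableSet_eval_eq (H : Standing lam dd P α ν c₃ C₃) (k : ℕ) (y : V) :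
    MeasurableSet {ω : ℕ → V | ω k = y} := by
  have := H.measurableSingletonClass
  have h : Measurable fun ω : ℕ → V => ω k := measurable_pi_apply k
  exact h (measurableSet_singleton y)

lemma chapman_kolmogorov (H : Standing lam dd P α ν c₃ C₃) (x z : V) (k n : ℕ) :
    P x {ω | ω (k + n) = z} = ∑' y, P x {ω | ω k = y} * P y {ω | ω n = z} := by
  have := H.countable
  have hU : {ω : ℕ → V | ω (k + n) = z}
      = ⋃ y, {ω | ω k = y} ∩ {ω | (fun i => ω (k + i)) ∈ {ω : ℕ → V | ω n = z}} := by
    ext ω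
    simp
  rw [hU, measure_iUnion]
  · exact tsum_congr fun y => H.markov x y k _ (H.measurableSet_eval_eq n z)
  · intro y y' hne
    refine Set.disjoint_left.2 fun ω h h' => hne ?_
    exact h.1.symm.trans h'.1
  · intro y
    exact (H.measurableSet_eval_eq k y).inter (H.measurableSet_eval_eq (k + n) z)

lemma toReal_step (H : Standing lam dd P α ν c₃ C₃) (x y : V) :
    (P x {ω | ω 1 = y}).toReal = lam x y / lamTot lam x := by
  rw [H.step, ENNReal.toReal_ofReal (div_nonneg (H.lam_nonneg x y) (H.lamTot_pos x).le)]

lemma visit_zero (H : Standing lam dd P α ν c₃ C₃) (x y : V) :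
    (P x {ω | ω 0 = y}).toReal = if x = y then 1 else 0 := by
  split_ifs with h
  · rw [← h, H.start, ENNReal.toReal_one]
  · have := H.prob x
    have h0 : P x {ω | ω 0 = x}ᶜ = 0 :=
      (prob_compl_eq_zero_iff (H.measurableSet_eval_eq 0 x)).2 (H.start x)
    have hsub : {ω : ℕ → V | ω 0 = y} ⊆ {ω | ω 0 = x}ᶜ := fun ω (hω : ω 0 = y) (hx : ω 0 = x) =>
      h (hx.symm.trans hω)
    rw [measure_mono_null hsub h0, ENNReal.toReal_zero]

lemma visit_succ_left (H : Standing lam dd P α ν c₃ C₃) (x z : V) (k : ℕ) :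
    (P x {ω | ω (k + 1) = z}).toReal
      = ∑ w ∈ H.nbhd x, lam x w / lamTot lam x * (P w {ω | ω k = z}).toReal := by
  have := H.prob
  rw [add_comm k 1, H.chapman_kolmogorov, tsum_eq_sum (s := H.nbhd x), ENNReal.toReal_sum]
  · exact Finset.sum_congr rfl fun w _ => by rw [ENNReal.toReal_mul, H.toReal_step]
  · exact fun w _ => ENNReal.mul_ne_top (measure_ne_top _ _) (measure_ne_top _ _)
  · intro w hw
    rw [H.step, H.lam_eq_zero hw, zero_div, ENNReal.ofReal_zero, zero_mul]

lemma visit_succ_right (H : Standing lam dd P α ν c₃ C₃) (x z : V) (k : ℕ) :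
    (P x {ω | ω (k + 1) = z}).toReal
      = ∑ w ∈ H.nbhd z, (P x {ω | ω k = w}).toReal * (lam w z / lamTot lam w) := by
  have := H.prob
  rw [H.chapman_kolmogorov, tsum_eq_sum (s := H.nbhd z), ENNReal.toReal_sum]
  · exact Finset.sum_congr rfl fun w _ => by rw [ENNReal.toReal_mul, H.toReal_step]
  · exact fun w _ => ENNReal.mul_ne_top (measure_ne_top _ _) (measure_ne_top _ _)
  · intro w hw
    rw [H.step, H.lam_symm, H.lam_eq_zero hw, zero_div, ENNReal.ofReal_zero, mul_zero]

lemma visit_symm (H : Standing lam dd P α ν c₃ C₃) (k : ℕ) (x z : V) :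
    lamTot lam x * (P x {ω | ω k = z}).toReal = lamTot lam z * (P z {ω | ω k = x}).toReal := by
  induction k generalizing x z with
  | zero =>
    rw [H.visit_zero, H.visit_zero]
    by_cases h : x = z
    · rw [h]
    · rw [if_neg h, if_neg (Ne.symm h), mul_zero, mul_zero]
  | succ k ih =>
    rw [H.visit_succ_left x, H.visit_succ_right z, Finset.mul_sum, Finset.mul_sum]
    refine Finset.sum_congr rfl fun w _ => ?_
    have hx := (H.lamTot_pos x).ne'
    have hw := (H.lamTot_pos w).ne'
    rw [← mul_assoc, mul_div_cancel₀ _ hx, ← mul_assoc, ← ih w z, H.lam_symm w x]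
    field_simp

lemma green_pos (H : Standing lam dd P α ν c₃ C₃) (x y : V) : 0 < green lam P x y := by
  obtain ⟨c₂, C₂, hc₂, -, hd, ho⟩ := H.greenBounds
  by_cases h : x = y
  · rw [← h]
    exact hc₂.trans_le (hd x).1
  · exact (mul_pos hc₂ (Real.rpow_pos_of_pos (H.dd_pos x y h) _)).trans_le (ho x y h).1

lemma summable_visit (H : Standing lam dd P α ν c₃ C₃) (x y : V) :
    Summable fun k : ℕ => (P x {ω | ω k = y}).toReal := by
  by_contra h
  have := H.green_pos x y
  rw [green, tsum_eq_zero_of_not_summable h, mul_zero] at this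
  exact lt_irrefl _ this

lemma green_symm (H : Standing lam dd P α ν c₃ C₃) (x y : V) :
    green lam P x y = green lam P y x := by
  have h : lamTot lam x * ∑' k : ℕ, (P x {ω | ω k = y}).toReal
      = lamTot lam y * ∑' k : ℕ, (P y {ω | ω k = x}).toReal := by
    rw [← tsum_mul_left, ← tsum_mul_left]
    exact tsum_congr fun k => H.visit_symm k x y
  have hx := (H.lamTot_pos x).ne'
  have hy := (H.lamTot_pos y).ne'
  rw [green, green]
  field_simp
  linarith

lemma green_eq (H : Standing lam dd P α ν c₃ C₃) (x y : V) :
    green lam P x y = (if x = y then (lamTot lam y)⁻¹ else 0)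
      + ∑ w ∈ H.nbhd x, lam x w / lamTot lam x * green lam P w y := by
  have h : ∑' k : ℕ, (P x {ω | ω (k + 1) = y}).toReal
      = ∑ w ∈ H.nbhd x, lam x w / lamTot lam x * ∑' k : ℕ, (P w {ω | ω k = y}).toReal := by
    simp_rw [H.visit_succ_left x y, ← tsum_mul_left]
    exact Summable.tsum_finsetSum fun w _ => (H.summable_visit w y).mul_left _
  rw [green, (H.summable_visit x y).tsum_eq_zero_add, h, H.visit_zero, mul_add, Finset.mul_sum]
  congr 1
  · rw [mul_ite, mul_one, mul_zero]
  · refine Finset.sum_congr rfl fun w _ => ?_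
    rw [green]
    ring

lemma mem_of_visit_ne_zero (H : Standing lam dd P α ν c₃ C₃) {M : Set V}
    (hM : ∀ x ∈ M, ∀ y ∈ H.nbhd x, y ∈ M) (k : ℕ) {x y : V} (hx : x ∈ M)
    (h : (P x {ω | ω k = y}).toReal ≠ 0) : y ∈ M := by
  induction k generalizing x with
  | zero =>
    rw [H.visit_zero] at h
    split_ifs at h with e
    · exact e ▸ hx
    · exact absurd rfl h
  | succ k ih =>
    rw [H.visit_succ_left] at h
    obtain ⟨w, hw, hne⟩ := Finset.exists_ne_zero_of_sum_ne_zero h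
    exact ih (hM x hx w hw) (right_ne_zero_of_mul hne)

lemma mem_of_closed (H : Standing lam dd P α ν c₃ C₃) (M : Set V)
    (hM : ∀ x ∈ M, ∀ y ∈ H.nbhd x, y ∈ M) (x : V) (hx : x ∈ M) (y : V) : y ∈ M := by
  have hg := (H.green_pos x y).ne'
  rw [green] at hg
  obtain ⟨k, hk⟩ : ∃ k : ℕ, (P x {ω | ω k = y}).toReal ≠ 0 := by
    by_contra! h
    simp [h] at hg
  exact H.mem_of_visit_ne_zero hM k hx hk

lemma inv_lamTot_le_green (H : Standing lam dd P α ν c₃ C₃) (x : V) :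
    (lamTot lam x)⁻¹ ≤ green lam P x x := by
  rw [H.green_eq, if_pos rfl]
  exact le_add_of_nonneg_right (Finset.sum_nonneg fun w _ =>
    mul_nonneg (div_nonneg (H.lam_nonneg _ _) (H.lamTot_pos _).le) (H.green_pos _ _).le)

lemma finite_vball (H : Standing lam dd P α ν c₃ C₃) (x : V) (r : ℝ) : (vball dd x r).Finite := by
  obtain ⟨c₂, C₂, hc₂, hcC, hd, -⟩ := H.greenBounds
  obtain ⟨c₁, C₁, hc₁, -, hv⟩ := H.vol
  have hC₂ : 0 < C₂ := hc₂.trans_le hcC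
  refine Set.Finite.subset (s := vball dd x (max r 1)) ?_ fun y (hy : dd x y ≤ r) =>
    show dd x y ≤ max r 1 from hy.trans (le_max_left _ _)
  have h1 := (hv x (max r 1) (le_max_right _ _)).1
  have h2 : 0 < c₁ * (max r 1) ^ α :=
    mul_pos hc₁ (Real.rpow_pos_of_pos (lt_of_lt_of_le one_pos (le_max_right _ _)) _)
  have hs : Summable fun y : vball dd x (max r 1) => lamTot lam y := by
    by_contra h
    rw [tsum_eq_zero_of_not_summable h] at h1
    linarith
  have hc : Summable fun _ : vball dd x (max r 1) => C₂⁻¹ := by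
    refine Summable.of_nonneg_of_le (fun _ => by positivity) (fun y => ?_) hs
    exact inv_le_of_inv_le₀ (H.lamTot_pos y) ((H.inv_lamTot_le_green y).trans (hd y).2)
  by_contra hinf
  have : Infinite (vball dd x (max r 1)) := Set.infinite_coe_iff.2 hinf
  rw [summable_const_iff] at hc
  exact (inv_pos.2 hC₂).ne' hc

/-- The ball `B(x,r)` as a finite set. -/
def ball (H : Standing lam dd P α ν c₃ C₃) (x : V) (r : ℝ) : Finset V :=
  (H.finite_vball x r).toFinset

lemma coe_ball (H : Standing lam dd P α ν c₃ C₃) (x : V) (r : ℝ) :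
    (H.ball x r : Set V) = vball dd x r := by
  simp [ball]

lemma mem_ball (H : Standing lam dd P α ν c₃ C₃) (x y : V) (r : ℝ) :
    y ∈ H.ball x r ↔ dd x y ≤ r := by
  simp [ball, vball]

lemma tsum_vball (H : Standing lam dd P α ν c₃ C₃) (x : V) (r : ℝ) (f : V → ℝ) :
    ∑' y : vball dd x r, f y = ∑ y ∈ H.ball x r, f y := by
  rw [← H.coe_ball]
  exact Finset.tsum_subtype' _ _

lemma exists_isGreenKernel (H : Standing lam dd P α ν c₃ C₃) :
    ∃ c₁ C₁ c₂ C₂ J : ℝ, IsGreenKernel dd (fun x y => lam x y / lamTot lam x) (green lam P) H.nbhd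
      (lamTot lam) H.ball α ν c₁ C₁ c₂ C₂ J := by
  obtain ⟨c₂, C₂, hc₂, hcC, hd, ho⟩ := H.greenBounds
  obtain ⟨c₁, C₁, hc₁, -, hv⟩ := H.vol
  obtain ⟨c, hc, hp⟩ := H.p0
  have hC₂ : 0 < C₂ := hc₂.trans_le hcC
  refine ⟨c₁, C₁, c₂, C₂, (C₂ / (c * c₂)) ^ ν⁻¹, ?_⟩
  exact
    { p_pos := fun x y hy => div_pos (H.mem_nbhd.1 hy) (H.lamTot_pos x)
      p_sum := H.sum_div_lamTot
      m_pos := H.lamTot_pos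
      g_eq := H.green_eq
      irred := H.mem_of_closed
      dd_self := H.dd_self
      dd_pos := H.dd_pos
      dd_symm := H.dd_symm
      dd_triangle := H.dd_triangle
      mem_ball := fun x r y => H.mem_ball x y r
      vol_lower := fun x r hr => by rw [← H.tsum_vball]; exact (hv x r hr).1
      vol_upper := fun x r hr => by rw [← H.tsum_vball]; exact (hv x r hr).2
      g_diag_lower := fun x => (hd x).1
      g_diag_upper := fun x => (hd x).2
      g_lower := fun x y h => (ho x y h).1
      g_upper := fun x y h => (ho x y h).2
      c₁_pos := hc₁
      c₂_pos := hc₂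
      nu_pos := H.nu_pos
      nu_le := H.nu_le
      J_pos := Real.rpow_pos_of_pos (by positivity) _
      jump := fun x y hy => by
        have hl := H.mem_nbhd.1 hy
        have hxy : x ≠ y := fun h => by
          rw [h, H.lam_diag] at hl
          exact lt_irrefl _ hl
        have hdp := H.dd_pos x y hxy
        have h1 : c * c₂ ≤ C₂ * dd x y ^ (-ν) := by
          refine le_trans ?_ (ho x y hxy).2
          rw [H.green_eq, if_neg hxy, zero_add]
          refine le_trans ?_ (Finset.single_le_sum (fun w _ => mul_nonneg (div_nonneg
            (H.lam_nonneg _ _) (H.lamTot_pos _).le) (H.green_pos _ _).le) hy)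
          exact mul_le_mul (hp x y hl) (hd y).1 hc₂.le
            (div_nonneg (H.lam_nonneg _ _) (H.lamTot_pos _).le)
        rw [Real.rpow_neg hdp.le, ← div_eq_mul_inv, le_div_iff₀ (Real.rpow_pos_of_pos hdp _),
          mul_comm, ← le_div_iff₀ (by positivity)] at h1
        rw [Real.le_rpow_inv_iff_of_pos hdp.le (by positivity) H.nu_pos]
        exact h1 }

lemma measurableSet_avoidSet (H : Standing lam dd P α ν c₃ C₃) (A : Set V) :
    MeasurableSet (avoidSet A) := by
  have := H.countable
  have := H.measurableSingletonClass
  have e : avoidSet A = ⋂ k : ℕ, ⋂ _ : 1 ≤ k, {ω : ℕ → V | ω k ∈ A}ᶜ := by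
    ext ω
    simp [avoidSet]
  rw [e]
  exact MeasurableSet.iInter fun k => MeasurableSet.iInter fun _ =>
    ((measurable_pi_apply k) (Set.to_countable A).measurableSet).compl

lemma ae_finite_visits (H : Standing lam dd P α ν c₃ C₃) (x : V) :
    ∀ᵐ ω ∂P x, ∀ y, ∀ᶠ k : ℕ in atTop, ω k ≠ y := by
  have := H.countable
  have := H.prob x
  refine ae_all_iff.2 fun y => ?_
  have h := measure_setOfPred_frequently_eq_zero (μ := P x) (p := fun (k : ℕ) ω => ω k = y) (by
    have := (H.summable_visit x y).tsum_ofReal_ne_top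
    simpa only [ENNReal.ofReal_toReal (measure_ne_top (P x) _)] using this)
  rw [ae_iff]
  refine measure_mono_null (fun ω hω => ?_) h
  simpa [Filter.Frequently] using hω

/-- Last exit decomposition. -/
lemma sum_visit_mul_avoid (H : Standing lam dd P α ν c₃ C₃) (A : Finset V) {x : V}
    (hx : x ∈ A) :
    ∑ y ∈ A, (∑' k : ℕ, (P x {ω | ω k = y}).toReal) * (P y (avoidSet (A : Set V))).toReal
      = 1 := by
  have := H.prob
  set E : ℕ × A → Set (ℕ → V) := fun i =>
    {ω | ω i.1 = i.2} ∩ {ω | (fun n => ω (i.1 + n)) ∈ avoidSet (A : Set V)} with hE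
  have hshift : ∀ k : ℕ, Measurable fun (ω : ℕ → V) (n : ℕ) => ω (k + n) := fun k =>
    measurable_pi_lambda _ fun n => measurable_pi_apply (k + n)
  have hEm : ∀ i, MeasurableSet (E i) := fun i =>
    (H.measurableSet_eval_eq i.1 i.2).inter (hshift i.1 (H.measurableSet_avoidSet _))
  have hlt : ∀ ω (i j : ℕ × A), ω ∈ E i → ω ∈ E j → ¬ i.1 < j.1 := by
    intro ω i j hi hj hij
    have h1 : ω (i.1 + (j.1 - i.1)) ∉ (A : Set V) := hi.2 (j.1 - i.1) (by omega)
    have h2 : ω j.1 = j.2 := hj.1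
    rw [Nat.add_sub_cancel' hij.le, h2] at h1
    exact h1 j.2.2
  have hEd : Pairwise (Function.onFun Disjoint E) := by
    intro i j hne
    refine Set.disjoint_left.2 fun ω hi hj => hne ?_
    have h1 : i.1 = j.1 := le_antisymm (not_lt.1 (hlt ω j i hj hi)) (not_lt.1 (hlt ω i j hi hj))
    refine Prod.ext h1 (Subtype.ext ?_)
    have h2 : ω i.1 = i.2 := hi.1
    have h3 : ω j.1 = j.2 := hj.1
    rw [← h2, ← h3, h1]
  have hcov : P x (⋃ i, E i) = 1 := by
    have hst : ∀ᵐ ω ∂P x, ω 0 = x := by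
      rw [ae_iff]
      exact (prob_compl_eq_zero_iff (H.measurableSet_eval_eq 0 x)).2 (H.start x)
    rw [← prob_compl_eq_zero_iff (MeasurableSet.iUnion hEm), ← mem_ae_iff]
    filter_upwards [H.ae_finite_visits x, hst] with ω h1 h2
    have hev : ∀ᶠ k : ℕ in atTop, ω k ∉ A := by
      have := (Filter.eventually_all_finset A).2 fun y _ => h1 y
      filter_upwards [this] with k hk hkA
      exact hk _ hkA rfl
    obtain ⟨n, hn⟩ := eventually_atTop.1 hev
    have hne : ((Finset.range n).filter fun k => ω k ∈ A).Nonempty := by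
      refine ⟨0, Finset.mem_filter.2 ⟨Finset.mem_range.2 (Nat.pos_of_ne_zero fun h => ?_), ?_⟩⟩
      · exact hn 0 h.le (h2.symm ▸ hx)
      · exact h2.symm ▸ hx
    obtain ⟨k, hk, hmax⟩ := Finset.exists_max_image _ id hne
    have hkA := (Finset.mem_filter.1 hk).2
    refine mem_iUnion.2 ⟨(k, ⟨ω k, hkA⟩), rfl, fun i hi hiA => ?_⟩
    have hlt : k + i < n := not_le.1 fun h => hn _ h hiA
    have := hmax (k + i) (Finset.mem_filter.2 ⟨Finset.mem_range.2 hlt, hiA⟩)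
    simp only [id] at this
    omega
  have hsum : ∑' k : ℕ, ∑ y ∈ A, P x {ω | ω k = y} * P y (avoidSet (A : Set V)) = 1 := by
    rw [← hcov, measure_iUnion hEd hEm, ENNReal.tsum_prod (f := fun k y => P x (E (k, y)))]
    refine tsum_congr fun k => ?_
    rw [tsum_fintype, ← Finset.sum_coe_sort A]
    exact Finset.sum_congr rfl fun y _ => (H.markov x y k _ (H.measurableSet_avoidSet _)).symm
  have hreal := congrArg ENNReal.toReal hsum
  rw [ENNReal.tsum_toReal_eq, ENNReal.toReal_one] at hreal
  · rw [← hreal]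
    simp_rw [← tsum_mul_right]
    rw [← Summable.tsum_finsetSum fun y _ => (H.summable_visit x y).mul_right _]
    refine tsum_congr fun k => ?_
    rw [ENNReal.toReal_sum fun y _ => ENNReal.mul_ne_top (measure_ne_top _ _) (measure_ne_top _ _)]
    exact Finset.sum_congr rfl fun y _ => ENNReal.toReal_mul.symm
  · intro k
    exact ENNReal.sum_ne_top.2 fun y _ =>
      ENNReal.mul_ne_top (measure_ne_top _ _) (measure_ne_top _ _)

lemma equi_nonneg (H : Standing lam dd P α ν c₃ C₃) (A : Set V) (x : V) :
    0 ≤ equi lam P A x := by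
  unfold equi
  split_ifs
  · exact mul_nonneg (H.lamTot_pos x).le ENNReal.toReal_nonneg
  · exact le_rfl

lemma sum_green_mul_equi (H : Standing lam dd P α ν c₃ C₃) (A : Finset V) {x : V}
    (hx : x ∈ A) : ∑ y ∈ A, green lam P x y * equi lam P (A : Set V) y = 1 := by
  rw [← H.sum_visit_mul_avoid A hx]
  refine Finset.sum_congr rfl fun y hy => ?_
  have := (H.lamTot_pos y).ne'
  rw [green, equi, if_pos (Finset.mem_coe.2 hy)]
  field_simp

lemma capa_eq_sum (A : Finset V) :
    capa lam P (A : Set V) = ∑ y ∈ A, equi lam P (A : Set V) y :=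
  Finset.tsum_subtype' _ _

lemma capa_pos (H : Standing lam dd P α ν c₃ C₃) {A : Finset V} (hA : A.Nonempty) :
    0 < capa lam P (A : Set V) := by
  obtain ⟨x, hx⟩ := hA
  have h := H.sum_green_mul_equi A hx
  rw [capa_eq_sum]
  refine lt_of_le_of_ne (Finset.sum_nonneg fun y _ => H.equi_nonneg _ y) fun h0 => ?_
  have h1 := (Finset.sum_eq_zero_iff_of_nonneg fun y _ => H.equi_nonneg _ y).1 h0.symm
  rw [Finset.sum_eq_zero fun y hy => by rw [h1 y hy, mul_zero]] at h
  exact zero_ne_one h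

end Standing

namespace Standing

variable {V : Type} [MeasurableSpace V] {lam dd : V → V → ℝ} {P : V → Measure (ℕ → V)}
  {α ν c₃ C₃ : ℝ}

lemma exists_green_le_mul (H : Standing lam dd P α ν c₃ C₃) (x₀ : V) {δ : ℝ} (hδ : 0 < δ)
    (hδ1 : δ < 1) : ∃ K₀ : ℝ, 1 < K₀ ∧ ∀ (z z' : V) (r : ℝ), 1 ≤ r → 2 * K₀ * r ≤ dd z z' →
      ∀ x ∈ H.ball z r, ∀ w ∈ H.ball z r, ∀ y ∈ H.ball z' r, ∀ y' ∈ H.ball z' r,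
        green lam P x y ≤ (1 + δ) * green lam P w y' := by
  obtain ⟨c₁, C₁, c₂, C₂, J, hG⟩ := H.exists_isGreenKernel
  obtain ⟨K₀, hK₀, hle⟩ := hG.exists_g_le_mul x₀ (δ := δ / 4) (by positivity)
  refine ⟨K₀, hK₀, fun z z' r hr hd x hx w hw y hy y' hy' => ?_⟩
  have hwz := (H.mem_ball z w r).1 hw
  have hyz := (H.mem_ball z' y r).1 hy
  have h1 : K₀ * r ≤ dd z y := by
    have := H.dd_triangle z y z'
    rw [H.dd_symm y z'] at this
    nlinarith
  have h2 : K₀ * r ≤ dd z' w := by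
    have := H.dd_triangle z w z'
    rw [H.dd_symm w z'] at this
    nlinarith
  have h3 := hle z y r hr h1 x hx w hw
  have h4 := hle z' w r hr h2 y hy y' hy'
  rw [H.green_symm y w, H.green_symm y' w] at h4
  have h5 := H.green_pos w y'
  calc green lam P x y ≤ (1 + δ / 4) * ((1 + δ / 4) * green lam P w y') :=
        h3.trans (mul_le_mul_of_nonneg_left h4 (by positivity))
    _ = (1 + δ / 4) ^ 2 * green lam P w y' := by ring
    _ ≤ _ := mul_le_mul_of_nonneg_right (by nlinarith) h5.le

lemma equi_of_notMem {A : Set V} {x : V} (hx : x ∉ A) : equi lam P A x = 0 := if_neg hx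

/-- The normalized equilibrium measure of a ball. -/
def ballEqui (H : Standing lam dd P α ν c₃ C₃) (r : ℝ) (z x : V) : ℝ :=
  equi lam P (H.ball z r : Set V) x / capa lam P (H.ball z r : Set V)

lemma ballEqui_nonneg (H : Standing lam dd P α ν c₃ C₃) (r : ℝ) (z x : V) :
    0 ≤ H.ballEqui r z x := by
  refine div_nonneg (H.equi_nonneg _ _) ?_
  rw [capa_eq_sum]
  exact Finset.sum_nonneg fun y _ => H.equi_nonneg _ y

lemma ballEqui_of_notMem (H : Standing lam dd P α ν c₃ C₃) {r : ℝ} {z x : V}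
    (hx : x ∉ H.ball z r) : H.ballEqui r z x = 0 := by
  rw [ballEqui, equi_of_notMem (mt Finset.mem_coe.1 hx), zero_div]

lemma ball_nonempty (H : Standing lam dd P α ν c₃ C₃) (z : V) {r : ℝ} (hr : 0 ≤ r) :
    (H.ball z r).Nonempty :=
  ⟨z, (H.mem_ball z z r).2 (by rwa [H.dd_self])⟩

lemma sum_ballEqui (H : Standing lam dd P α ν c₃ C₃) (z : V) {r : ℝ} (hr : 0 ≤ r) :
    ∑ x ∈ H.ball z r, H.ballEqui r z x = 1 := by
  unfold ballEqui
  rw [← Finset.sum_div, ← capa_eq_sum, div_self (H.capa_pos (H.ball_nonempty z hr)).ne']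

lemma sum_green_mul_ballEqui (H : Standing lam dd P α ν c₃ C₃) {x z : V} {r : ℝ}
    (hx : x ∈ H.ball z r) : ∑ y ∈ H.ball z r, green lam P x y * H.ballEqui r z y
      = (capa lam P (H.ball z r : Set V))⁻¹ := by
  simp_rw [ballEqui, ← mul_div_assoc]
  rw [← Finset.sum_div, H.sum_green_mul_equi _ hx, one_div]

/-- The union of the balls of radius `8L` around the points of `Z`. -/
def unionBalls (H : Standing lam dd P α ν c₃ C₃) (L : ℝ) (Z : Finset V) : Finset V :=
  Z.biUnion fun z => H.ball z (8 * L)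

lemma coe_unionBalls (H : Standing lam dd P α ν c₃ C₃) (L : ℝ) (Z : Finset V) :
    (H.unionBalls L Z : Set V) = SigmaSet dd L (Z : Set V) := by
  simp only [unionBalls, SigmaSet, Finset.coe_biUnion, coe_ball, Finset.mem_coe]

lemma ball_subset_unionBalls (H : Standing lam dd P α ν c₃ C₃) {L : ℝ} {Z : Finset V} {z : V}
    (hz : z ∈ Z) : H.ball z (8 * L) ⊆ H.unionBalls L Z :=
  Finset.subset_biUnion_of_mem (fun z => H.ball z (8 * L)) hz

lemma Vfun_eq_sum (H : Standing lam dd P α ν c₃ C₃) (L : ℝ) (Z : Finset V) (x : V) :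
    Vfun lam dd P L (Z : Set V) x = ∑ z ∈ Z, (∑ w ∈ H.ball z (8 * L),
      equi lam P (H.unionBalls L Z : Set V) w) * H.ballEqui (8 * L) z x := by
  have h := Finset.tsum_subtype' Z fun z => (∑' w : vball dd z (8 * L),
    equi lam P (SigmaSet dd L (Z : Set V)) w) * (equi lam P (vball dd z (8 * L)) x /
      capa lam P (vball dd z (8 * L)))
  refine Eq.trans h (Finset.sum_congr rfl fun z _ => ?_)
  rw [H.tsum_vball, ballEqui, coe_ball, coe_unionBalls]

lemma locAvg_eq_sum (H : Standing lam dd P α ν c₃ C₃) (L : ℝ) (z : V) {Ω : Type}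
    (ℓ : V → Ω → ℝ) (ω : Ω) : locAvg lam dd P L z ℓ ω
      = ∑ x ∈ H.ball z (8 * L), H.ballEqui (8 * L) z x * ℓ x ω := by
  rw [locAvg, H.tsum_vball z (8 * L) fun x => equi lam P (vball dd z (8 * L)) x /
    capa lam P (vball dd z (8 * L)) * ℓ x ω]
  simp_rw [ballEqui, coe_ball]

lemma sum_mul_Vfun (H : Standing lam dd P α ν c₃ C₃) (L : ℝ) (Z : Finset V) (φ : V → ℝ) :
    ∑ x ∈ H.unionBalls L Z, φ x * Vfun lam dd P L (Z : Set V) x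
      = ∑ z ∈ Z, (∑ w ∈ H.ball z (8 * L), equi lam P (H.unionBalls L Z : Set V) w) *
        ∑ x ∈ H.ball z (8 * L), φ x * H.ballEqui (8 * L) z x := by
  simp_rw [H.Vfun_eq_sum, Finset.mul_sum]
  rw [Finset.sum_comm]
  refine Finset.sum_congr rfl fun z hz => ?_
  rw [← Finset.sum_subset (H.ball_subset_unionBalls hz) fun x _ hx => by
    rw [H.ballEqui_of_notMem hx, mul_zero, mul_zero]]
  exact Finset.sum_congr rfl fun x _ => by ring

lemma Vfun_nonneg (H : Standing lam dd P α ν c₃ C₃) (L : ℝ) (Z : Finset V) (x : V) :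
    0 ≤ Vfun lam dd P L (Z : Set V) x := by
  rw [H.Vfun_eq_sum]
  exact Finset.sum_nonneg fun z _ => mul_nonneg
    (Finset.sum_nonneg fun w _ => H.equi_nonneg _ w) (H.ballEqui_nonneg _ _ _)

lemma Vfun_of_notMem (H : Standing lam dd P α ν c₃ C₃) {L : ℝ} {Z : Finset V} {x : V}
    (hx : x ∉ H.unionBalls L Z) : Vfun lam dd P L (Z : Set V) x = 0 := by
  rw [H.Vfun_eq_sum]
  refine Finset.sum_eq_zero fun z hz => ?_
  rw [H.ballEqui_of_notMem fun h => hx (H.ball_subset_unionBalls hz h), mul_zero]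

end Standing

/-- If an event of probability at most `ε` covers the complement of `E`, then `E` has
probability at least `1 - ε`. -/
lemma ofReal_one_sub_le_measure {Ω : Type*} [MeasurableSpace Ω] {μ : Measure Ω}
    [IsProbabilityMeasure μ] {E F : Set Ω} {ε : ℝ} (hε : 0 ≤ ε) (hF : μ F ≤ ENNReal.ofReal ε)
    (h : Eᶜ ⊆ F) : ENNReal.ofReal (1 - ε) ≤ μ E := by
  rw [ENNReal.ofReal_sub _ hε, ENNReal.ofReal_one, tsub_le_iff_right]
  calc (1 : ℝ≥0∞) = μ (E ∪ Eᶜ) := by rw [union_compl_self, measure_univ]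
    _ ≤ μ E + μ Eᶜ := measure_union_le _ _
    _ ≤ _ := add_le_add_right ((measure_mono h).trans hF) _

/-- Proposition `pro:thm4.2disco`: exponential decoupling bound
for the total weighted time spent by interlacements near a spread-out family. -/
theorem statement12
    (V : Type) [MeasurableSpace V]
    (lam dd : V → V → ℝ) (P : V → Measure (ℕ → V)) (α ν c₃ C₃ : ℝ)
    (hSt : Standing lam dd P α ν c₃ C₃)
    (Lam : ℝ → Set V) (hLam : LamFamily dd α Lam) :
    ∀ η : ℝ, η ∈ Set.Ioo (0:ℝ) 1 →
    ∃ K₀ : ℝ, 0 < K₀ ∧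
    ∀ K L : ℝ, K₀ ≤ K → 1 ≤ L → ∀ u v : ℝ, 0 < u → 0 < v →
    ∀ 𝒞 : Set V, 𝒞.Nonempty → 𝒞.Finite → 𝒞 ⊆ Lam L →
      (∀ z ∈ 𝒞, ∀ z' ∈ 𝒞, z ≠ z' → 16 * K * L ≤ dd z z') →
    ∀ (Ω : Type) [MeasurableSpace Ω] (μ : Measure Ω) [IsProbabilityMeasure μ]
      (ℓx : V → Ω → ℝ),
      (∀ x ω, 0 ≤ ℓx x ω) →
      (∀ Vf : V → ℝ, (Function.support Vf).Finite →
        (∃ r : ℝ, r < 1 ∧ ∀ x : V, ∑' y, |green lam P x y * Vf y| ≤ r) →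
        ∫ ω, Real.exp (∑' x, Vf x * ℓx x ω) ∂μ
          = Real.exp (v * ∑' x, Vf x *
              (∑' n : ℕ, (GVop (green lam P) Vf)^[n] (fun _ => 1) x))) →
      (u < v →
        μ {ω | ∑' x : V, Vfun lam dd P L 𝒞 x * ℓx x ω
              ≤ u * capa lam P (SigmaSet dd L 𝒞)}
          ≤ ENNReal.ofReal (Real.exp (-((Real.sqrt v - Real.sqrt u) ^ 2 *
              capa lam P (SigmaSet dd L 𝒞) / (1 + η))))) ∧
      (v < u →
        μ {ω | u * capa lam P (SigmaSet dd L 𝒞)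
              ≤ ∑' x : V, Vfun lam dd P L 𝒞 x * ℓx x ω}
          ≤ ENNReal.ofReal (Real.exp (-((Real.sqrt u - Real.sqrt v) ^ 2 *
              capa lam P (SigmaSet dd L 𝒞) / (1 + η))))) ∧
      (u < v →
        ENNReal.ofReal (1 - Real.exp (-((Real.sqrt v - Real.sqrt u) ^ 2 *
            capa lam P (SigmaSet dd L 𝒞) / (1 + η))))
          ≤ μ {ω | ∃ z ∈ 𝒞, u < locAvg lam dd P L z ℓx ω}) ∧
      (v < u →
        ENNReal.ofReal (1 - Real.exp (-((Real.sqrt u - Real.sqrt v) ^ 2 *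
            capa lam P (SigmaSet dd L 𝒞) / (1 + η))))
          ≤ μ {ω | ∃ z ∈ 𝒞, locAvg lam dd P L z ℓx ω < u}) := by
  rintro η ⟨hη0, hη1⟩
  rcases isEmpty_or_nonempty V with hV | ⟨⟨x₀⟩⟩
  · exact ⟨1, one_pos, fun _ _ _ _ _ _ _ _ 𝒞 h𝒞 => (hV.false h𝒞.some).elim⟩
  obtain ⟨K₀, hK₀, hfar⟩ := hSt.exists_green_le_mul x₀ hη0 hη1
  obtain ⟨c₁, C₁, c₂, C₂, J, hG⟩ := hSt.exists_isGreenKernel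
  refine ⟨K₀, by linarith, fun K L hK hL u v hu hv 𝒞 h𝒞 hfin _ hsep Ω _ μ _ ℓx hℓ hlap => ?_⟩
  obtain ⟨Z, rfl⟩ := hfin.exists_finset_coe
  have h8 : 0 ≤ 8 * L := by linarith
  set S : Finset V := hSt.unionBalls L Z with hS
  set W : V → ℝ := Vfun lam dd P L (Z : Set V) with hW
  set e : V → ℝ := equi lam P (S : Set V) with he
  have hKL : L < K * L := by nlinarith
  have hdisj : ∀ z ∈ Z, ∀ z' ∈ Z, z ≠ z' →
      Disjoint (hSt.ball z (8 * L)) (hSt.ball z' (8 * L)) := by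
    refine fun z hz z' hz' hne => Finset.disjoint_left.2 fun x hx hx' => ?_
    rw [hSt.mem_ball] at hx hx'
    have h1 := hsep z hz z' hz' hne
    have h2 := hSt.dd_triangle z x z'
    rw [hSt.dd_symm x z'] at h2
    linarith
  have hcap : capa lam P (SigmaSet dd L (Z : Set V)) = ∑ x ∈ S, e x := by
    rw [← hSt.coe_unionBalls, Standing.capa_eq_sum]
  have hesum : ∑ z ∈ Z, ∑ w ∈ hSt.ball z (8 * L), e w = ∑ x ∈ S, e x :=
    (Finset.sum_biUnion fun z hz z' hz' hne => hdisj z hz z' hz' hne).symm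
  have hc : 0 < ∑ x ∈ S, e x := by
    obtain ⟨z, hz⟩ := h𝒞
    rw [he, ← Standing.capa_eq_sum]
    exact hSt.capa_pos ((hSt.ball_nonempty z h8).mono (hSt.ball_subset_unionBalls hz))
  have hWsum : ∑ x ∈ S, W x = ∑ x ∈ S, e x := by
    have := hSt.sum_mul_Vfun L Z fun _ => 1
    simp only [one_mul, hSt.sum_ballEqui _ h8, mul_one] at this
    rw [← hesum]
    exact this
  have hWℓ : ∀ ω, ∑ x ∈ S, W x * ℓx x ω
      = ∑ z ∈ Z, (∑ w ∈ hSt.ball z (8 * L), e w) * locAvg lam dd P L z ℓx ω := fun ω => by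
    have := hSt.sum_mul_Vfun L Z fun x => ℓx x ω
    simp_rw [hSt.locAvg_eq_sum, mul_comm _ (ℓx _ ω)]
    exact this
  have htsum : ∀ ω, ∑' x, W x * ℓx x ω = ∑ x ∈ S, W x * ℓx x ω := fun ω =>
    tsum_eq_sum fun x hx => by rw [hW, hSt.Vfun_of_notMem hx, zero_mul]
  have hbd : ∀ x, ∑ y ∈ S, green lam P x y * W y ≤ 1 + η := by
    refine hG.potential_le S W (fun y _ => hSt.Vfun_nonneg L Z y) (by linarith) fun x hx => ?_
    have h1 := hSt.sum_mul_Vfun L Z fun y => green lam P x y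
    refine h1.le.trans ?_
    refine sum_potential_le (green lam P) (fun x y => (hSt.green_pos x y).le) hSt.green_symm Z
      (fun z => hSt.ball z (8 * L)) hdisj e (hSt.equi_nonneg _)
      (fun x hx => hSt.sum_green_mul_equi S hx) (hSt.ballEqui (8 * L)) _
      (hSt.ballEqui_nonneg _) (fun z _ => hSt.sum_ballEqui z h8)
      (fun z _ x hx => hSt.sum_green_mul_ballEqui hx) hη0.le (fun z hz z' hz' hne => ?_) x hx
    refine hfar z z' (8 * L) (by linarith) ?_
    have := hsep z hz z' hz' hne
    nlinarith
  have hloc : LaplaceIdentity μ (green lam P) v ℓx := hlap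
  obtain ⟨hlow, hupp⟩ := hloc.tail_bounds hv hℓ (fun x y => (hSt.green_pos x y).le) hG.g_le
    hSt.green_symm (hSt.Vfun_nonneg L Z) (fun x hx => hSt.Vfun_of_notMem hx)
    (by linarith : 0 < 1 + η) hbd hc hWsum hu
  simp_rw [hcap, htsum]
  have he0 : ∀ z, 0 ≤ ∑ w ∈ hSt.ball z (8 * L), e w := fun z =>
    Finset.sum_nonneg fun w _ => hSt.equi_nonneg _ w
  refine ⟨hlow, hupp, fun h => ofReal_one_sub_le_measure (Real.exp_pos _).le (hlow h) ?_,
    fun h => ofReal_one_sub_le_measure (Real.exp_pos _).le (hupp h) ?_⟩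
  · intro ω hω
    have hω' : ∀ z ∈ Z, locAvg lam dd P L z ℓx ω ≤ u := by simpa using hω
    change ∑ x ∈ S, W x * ℓx x ω ≤ u * ∑ x ∈ S, e x
    rw [hWℓ, ← hesum, mul_comm u, Finset.sum_mul]
    exact Finset.sum_le_sum fun z hz => mul_le_mul_of_nonneg_left (hω' z hz) (he0 z)
  · intro ω hω
    have hω' : ∀ z ∈ Z, u ≤ locAvg lam dd P L z ℓx ω := by simpa using hω
    change u * ∑ x ∈ S, e x ≤ ∑ x ∈ S, W x * ℓx x ω
    rw [hWℓ, ← hesum, mul_comm u, Finset.sum_mul]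
    exact Finset.sum_le_sum fun z hz => mul_le_mul_of_nonneg_left (hω' z hz) (he0 z)

end Paper
end
end

section
/- There exists a constant C_κ∈(1,∞) such that for all L≥1, K≥2, κ≥C_κ, k∈ℕ₀, x∈G, and every L-nearest-neighbor path γ from B(x,l_k) to B(x,2L_k)^c, there exists a k-proper embedding τ with base x such that B(τ(σ),l₀)∩γ ≠ ∅ for every σ∈T^{(k)}. -/
open MeasureTheory Set Filter
open scoped ENNReal Topology Classical

noncomputable section

namespace Paper

variable {V : Type}

variable [MeasurableSpace V]

/-- The scales `L_k`: `L₀ = κLK`, `L_{k+1} = 2(L_k + κ l_k)` with `l_k = L_k/(k+1)²`. -/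
def Lsc (L K κ : ℝ) : ℕ → ℝ
  | 0 => κ * L * K
  | k + 1 => 2 * (Lsc L K κ k + κ * (Lsc L K κ k / ((k : ℝ) + 1) ^ 2))

/-- `l_k = L_k/(k+1)²`. -/
def lsc (L K κ : ℝ) (k : ℕ) : ℝ := Lsc L K κ k / ((k : ℝ) + 1) ^ 2

/-- `I_k(x) = Λ(l_k) ∩ B(x, l_{k+1} + l_k)`. -/
def Ifam (dd : V → V → ℝ) (Lam : ℝ → Set V) (L K κ : ℝ) (k : ℕ) (x : V) : Set V :=
  Lam (lsc L K κ k) ∩ vball dd x (lsc L K κ (k + 1) + lsc L K κ k)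

/-- `E_k(x) = Λ(l_k) ∩ (B(x, 2l_k + L_{k+1}) \ B(x, L_{k+1} - l_k))`. -/
def Efam (dd : V → V → ℝ) (Lam : ℝ → Set V) (L K κ : ℝ) (k : ℕ) (x : V) : Set V :=
  Lam (lsc L K κ k) ∩
    (vball dd x (2 * lsc L K κ k + Lsc L K κ (k + 1)) \
      vball dd x (Lsc L K κ (k + 1) - lsc L K κ k))

/-- A `k`-proper embedding of the binary tree `T_k` (nodes = lists of booleans of
length at most `k`) with base `x`. -/
structure ProperEmbedding (lam dd : V → V → ℝ) (Lam : ℝ → Set V) (L K κ : ℝ)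
    (k : ℕ) (x : V) (τ : List Bool → V) : Prop where
  base : τ [] = x
  child : ∀ n : ℕ, n + 1 ≤ k → ∀ σ : List Bool, σ.length = n →
    τ (σ ++ [false]) ∈ Ifam dd Lam L K κ (k - n - 1) (τ σ) ∧
    τ (σ ++ [true]) ∈ Efam dd Lam L K κ (k - n - 1) (τ σ)
  sep : ∀ n ≤ k, ∀ σ σ' : List Bool, σ.length = n → σ'.length = n → σ ≠ σ' →
    2 * Lsc L K κ (k - n) + κ * lsc L K κ (k - n) ≤ dd (τ σ) (τ σ')
  near : ∀ n ≤ k, ∀ σ σ' : List Bool, σ.length = n → σ'.length = k - n →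
    (vball dd (τ σ) (2 * Lsc L K κ (k - n)) ∩
      vball dd (τ (σ ++ σ')) (2 * Lsc L K κ 0)).Nonempty

section JumpBound

variable {lam dd : V → V → ℝ} {P : V → Measure (ℕ → V)} {α ν c₃ C₃ : ℝ}

lemma green_pos (hSt : Standing lam dd P α ν c₃ C₃) (x y : V) (h : x = y ∨ 0 < lam x y) :
    0 < green lam P x y := by
  obtain ⟨c₂, C₂, hc, -, hd, ho⟩ := hSt.greenBounds
  by_cases hxy : x = y
  · subst hxy
    exact hc.trans_le (hd x).1
  · exact (mul_pos hc (Real.rpow_pos_of_pos (hSt.dd_pos x y hxy) _)).trans_le (ho x y hxy).1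

lemma lamTot_pos (hSt : Standing lam dd P α ν c₃ C₃) (x : V) : 0 < lamTot lam x := by
  have hnn : 0 ≤ lamTot lam x := tsum_nonneg (hSt.lam_nonneg x)
  refine lt_of_le_of_ne hnn fun h => ?_
  have := green_pos hSt x x (Or.inl rfl)
  simp [green, ← h] at this

lemma summable_hit (hSt : Standing lam dd P α ν c₃ C₃) {x y : V} (h : x = y ∨ 0 < lam x y) :
    Summable fun k : ℕ => (P x {ω | ω k = y}).toReal := by
  by_contra hs
  have := green_pos hSt x y h
  simp [green, tsum_eq_zero_of_not_summable hs] at this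

lemma tsum_step (hSt : Standing lam dd P α ν c₃ C₃) (x : V) :
    ∑' z, P x {ω | ω 1 = z} = 1 := by
  have hsum : Summable fun z => lam x z := by
    refine summable_of_hasFiniteSupport ((hSt.locFin x).subset fun z hz => ?_)
    exact lt_of_le_of_ne (hSt.lam_nonneg x z) (Ne.symm hz)
  have hpos := lamTot_pos hSt x
  simp_rw [hSt.step]
  rw [← ENNReal.ofReal_tsum_of_nonneg
    (fun z => div_nonneg (hSt.lam_nonneg x z) hpos.le) (hsum.div_const _), tsum_div_const]
  change ENNReal.ofReal (lamTot lam x / lamTot lam x) = 1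
  rw [div_self hpos.ne', ENNReal.ofReal_one]

lemma exists_neighbor (hSt : Standing lam dd P α ν c₃ C₃) (y : V) : ∃ x, 0 < lam x y := by
  by_contra! h
  have h0 : ∀ x, lam y x = 0 := fun x =>
    le_antisymm (hSt.lam_symm y x ▸ h x) (hSt.lam_nonneg y x)
  have := lamTot_pos hSt y
  simp [lamTot, h0] at this

/-- The assumptions on the law of the walk force points to be measurable. -/
lemma measurableSet_point (hSt : Standing lam dd P α ν c₃ C₃) (y : V) :
    MeasurableSet ({y} : Set V) := by
  obtain ⟨x, hx⟩ := exists_neighbor hSt y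
  have := hSt.countable
  have := hSt.prob x
  set A : Set (ℕ → V) := {ω | ω 1 = y} with hA
  have hApos : 0 < P x A := by
    rw [hA, hSt.step, ENNReal.ofReal_pos]
    exact div_pos hx (lamTot_pos hSt x)
  have hcompl : P x Aᶜ ≤ ∑' z, if z = y then 0 else P x {ω | ω 1 = z} := by
    have hsub : Aᶜ ⊆ ⋃ z, (if z = y then ∅ else {ω : ℕ → V | ω 1 = z}) := by
      intro ω hω
      refine mem_iUnion.2 ⟨ω 1, ?_⟩
      have : ω 1 ≠ y := hω
      simp [this]
    refine (measure_mono hsub).trans ((measure_iUnion_le _).trans (ENNReal.tsum_le_tsum fun z => ?_))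
    split_ifs <;> simp
  have htot : P x A + P x Aᶜ ≤ 1 := by
    rw [← tsum_step hSt x, ENNReal.tsum_eq_add_tsum_ite y]
    gcongr
  set T := toMeasurable (P x) Aᶜ
  have hTm : MeasurableSet T := measurableSet_toMeasurable _ _
  have hTne : T ≠ univ := by
    intro hT
    have h1 : P x Aᶜ = 1 := by
      rw [← measure_toMeasurable (μ := P x) Aᶜ]
      change P x T = 1
      rw [hT, measure_univ]
    rw [h1] at htot
    have h2 : (1 : ℝ≥0∞) < P x A + 1 := by
      rw [add_comm]
      exact ENNReal.lt_add_right ENNReal.one_ne_top hApos.ne'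
    exact absurd htot (not_le.2 h2)
  obtain ⟨ω, hω⟩ := (ne_univ_iff_exists_notMem T).1 hTne
  have hTA : ∀ ω', ω' ∉ T → ω' 1 = y := fun ω' h => by
    by_contra hne
    exact h (subset_toMeasurable (P x) Aᶜ hne)
  have hpre : ({y} : Set V) = (Function.update ω 1) ⁻¹' Tᶜ := by
    ext v
    simp only [mem_singleton_iff, mem_preimage, mem_compl_iff]
    constructor
    · rintro rfl
      rwa [← hTA ω hω, Function.update_eq_self]
    · intro h
      simpa using hTA _ h
  rw [hpre]
  exact (measurable_update ω) hTm.compl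

lemma step_mul_green_le (hSt : Standing lam dd P α ν c₃ C₃) {x y : V} (hxy : 0 < lam x y) :
    lam x y / lamTot lam x * green lam P y y ≤ green lam P x y := by
  have := hSt.prob x
  have hp : 0 ≤ lam x y / lamTot lam x := div_nonneg hxy.le (lamTot_pos hSt x).le
  have hstep : ∀ k : ℕ, lam x y / lamTot lam x * (P y {ω | ω k = y}).toReal
      ≤ (P x {ω | ω (k + 1) = y}).toReal := by
    intro k
    have hm : MeasurableSet {ω : ℕ → V | ω k = y} :=
      (measurable_pi_apply k : Measurable fun ω : ℕ → V => ω k) (measurableSet_point hSt y)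
    have h := hSt.markov x y 1 _ hm
    have hle : P x {ω | ω 1 = y} * P y {ω | ω k = y} ≤ P x {ω | ω (k + 1) = y} := by
      rw [← h]
      refine measure_mono fun ω hω => ?_
      have := hω.2
      simpa [add_comm] using this
    have := ENNReal.toReal_mono (measure_ne_top _ _) hle
    rwa [ENNReal.toReal_mul, hSt.step, ENNReal.toReal_ofReal hp] at this
  have hs := summable_hit hSt (x := x) (y := y) (Or.inr hxy)
  have hs1 := (summable_nat_add_iff 1).2 hs
  have hsum : lam x y / lamTot lam x * ∑' k : ℕ, (P y {ω | ω k = y}).toReal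
      ≤ ∑' k : ℕ, (P x {ω | ω k = y}).toReal := by
    rw [← tsum_mul_left, hs.tsum_eq_zero_add]
    have := ((summable_hit hSt (x := y) (Or.inl rfl)).mul_left
      (lam x y / lamTot lam x)).tsum_le_tsum hstep hs1
    have h0 : 0 ≤ (P x {ω | ω 0 = y}).toReal := ENNReal.toReal_nonneg
    linarith
  unfold green
  rw [mul_left_comm]
  exact mul_le_mul_of_nonneg_left hsum (inv_nonneg.2 (lamTot_pos hSt y).le)

/-- Neighbours are at uniformly bounded distance. -/
lemma exists_neighbor_dist_bound (hSt : Standing lam dd P α ν c₃ C₃) :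
    ∃ D : ℝ, 0 ≤ D ∧ ∀ x y, 0 < lam x y → dd x y ≤ D := by
  obtain ⟨c, hc, hp⟩ := hSt.p0
  obtain ⟨c₂, C₂, hc₂, hcC, hd, ho⟩ := hSt.greenBounds
  have hC₂ : 0 < C₂ := hc₂.trans_le hcC
  have hq : 0 < c * c₂ / C₂ := by positivity
  refine ⟨(c * c₂ / C₂) ^ (-ν⁻¹), by positivity, fun x y hxy => ?_⟩
  have hne : x ≠ y := by
    rintro rfl
    exact hxy.ne' (hSt.lam_diag x)
  have hdp := hSt.dd_pos x y hne
  have h1 : c * c₂ ≤ C₂ * dd x y ^ (-ν) :=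
    calc c * c₂ ≤ lam x y / lamTot lam x * green lam P y y :=
          mul_le_mul (hp x y hxy) (hd y).1 hc₂.le (hc.le.trans (hp x y hxy))
      _ ≤ green lam P x y := step_mul_green_le hSt hxy
      _ ≤ _ := (ho x y hne).2
  have h2 : c * c₂ / C₂ ≤ dd x y ^ (-ν) := by
    rw [div_le_iff₀ hC₂]
    linarith
  have h3 := Real.rpow_le_rpow_of_nonpos hq h2 (z := -ν⁻¹)
    (neg_nonpos.2 (inv_nonneg.2 hSt.nu_pos.le))
  rwa [← Real.rpow_mul hdp.le, neg_mul_neg, mul_inv_cancel₀ hSt.nu_pos.ne', Real.rpow_one] at h3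

end JumpBound

section Scales

variable {L K κ : ℝ}

lemma Lsc_succ_eq (k : ℕ) : Lsc L K κ (k + 1) = 2 * Lsc L K κ k + 2 * κ * lsc L K κ k := by
  simp only [Lsc, lsc]
  ring

lemma lsc_mul_sq (k : ℕ) : lsc L K κ k * ((k : ℝ) + 1) ^ 2 = Lsc L K κ k := by
  unfold lsc
  field_simp

lemma lsc_zero_eq : lsc L K κ 0 = Lsc L K κ 0 := by simp [lsc]

lemma Lsc_nonneg (hL : 0 ≤ L) (hK : 0 ≤ K) (hκ : 0 ≤ κ) (k : ℕ) : 0 ≤ Lsc L K κ k := by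
  induction k with
  | zero => simp only [Lsc]; positivity
  | succ k ih => simp only [Lsc]; positivity

lemma lsc_nonneg (hL : 0 ≤ L) (hK : 0 ≤ K) (hκ : 0 ≤ κ) (k : ℕ) : 0 ≤ lsc L K κ k :=
  div_nonneg (Lsc_nonneg hL hK hκ k) (by positivity)

lemma lsc_le_Lsc (hL : 0 ≤ L) (hK : 0 ≤ K) (hκ : 0 ≤ κ) (k : ℕ) :
    lsc L K κ k ≤ Lsc L K κ k := by
  refine div_le_self (Lsc_nonneg hL hK hκ k) ?_
  have : (0 : ℝ) ≤ k := k.cast_nonneg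
  nlinarith

lemma lsc_succ_le (hL : 0 ≤ L) (hK : 0 ≤ K) (hκ : 0 ≤ κ) (k : ℕ) :
    lsc L K κ (k + 1) ≤ (2 + κ / 2) * lsc L K κ k := by
  have hl := lsc_nonneg hL hK hκ k
  have hk : (0 : ℝ) ≤ k := k.cast_nonneg
  have h1 := lsc_mul_sq (L := L) (K := K) (κ := κ) k
  rw [lsc, Lsc_succ_eq, ← h1, div_le_iff₀ (by positivity)]
  push_cast
  have : 2 * ((k : ℝ) + 1) ^ 2 + 2 * κ ≤ (2 + κ / 2) * ((k : ℝ) + 1 + 1) ^ 2 := by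
    nlinarith [mul_nonneg hκ hk, mul_nonneg (mul_nonneg hκ hk) hk]
  nlinarith [mul_le_mul_of_nonneg_left this hl]

lemma lsc_mono (hL : 0 ≤ L) (hK : 0 ≤ K) (hκ : 1 ≤ κ) : Monotone (lsc L K κ) := by
  refine monotone_nat_of_le_succ fun k => ?_
  have hl := lsc_nonneg hL hK (zero_le_one.trans hκ) k
  have hk : (0 : ℝ) ≤ k := k.cast_nonneg
  have h1 := lsc_mul_sq (L := L) (K := K) (κ := κ) k
  rw [lsc.eq_def L K κ (k + 1), Lsc_succ_eq, ← h1, le_div_iff₀ (by positivity)]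
  push_cast
  have : ((k : ℝ) + 1 + 1) ^ 2 ≤ 2 * ((k : ℝ) + 1) ^ 2 + 2 * κ := by
    nlinarith [mul_nonneg hk hk]
  nlinarith [mul_le_mul_of_nonneg_left this hl]

end Scales

/-- Glue two labelled binary trees below a common root. -/
def treeJoin (x : V) (τ₀ τ₁ : List Bool → V) : List Bool → V
  | [] => x
  | false :: s => τ₀ s
  | true :: s => τ₁ s

lemma exists_last_le (f : ℕ → ℝ) (r : ℝ) (m : ℕ) (h0 : f 0 ≤ r) (hm : r < f m) :
    ∃ i < m, f i ≤ r ∧ ∀ j, i < j → j ≤ m → r < f j := by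
  induction m with
  | zero => exact absurd h0 (not_le.2 hm)
  | succ m ih =>
    by_cases h : f m ≤ r
    · refine ⟨m, m.lt_succ_self, h, fun j hj hj' => ?_⟩
      obtain rfl : j = m + 1 := by omega
      exact hm
    · obtain ⟨i, hi, hir, hj⟩ := ih (not_le.1 h)
      refine ⟨i, by omega, hir, fun j hij hjm => ?_⟩
      rcases Nat.lt_or_ge m j with h' | h'
      · obtain rfl : j = m + 1 := by omega
        exact hm
      · exact hj j hij h'

/-- A path with small jumps crossing the annulus at scale `k` carries a proper embedding all of
whose nodes are close to the path. -/
lemma exists_properEmbedding {W : Type} {lam dd : W → W → ℝ} {Lam : ℝ → Set W} {L K κ : ℝ}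
    (hself : ∀ x, dd x x = 0) (hsymm : ∀ x y, dd x y = dd y x)
    (htri : ∀ x y z, dd x z ≤ dd x y + dd y z)
    (hcover : ∀ r : ℝ, 1 ≤ r → ∀ x : W, ∃ y ∈ Lam r, dd y x ≤ r)
    (hL : 1 ≤ L) (hK : 2 ≤ K) (hκ : 8 ≤ κ) (k : ℕ) :
    ∀ (x : W) (γ : ℕ → W) (m : ℕ),
      (∀ i < m, dd (γ i) (γ (i + 1)) ≤ lsc L K κ 0) →
      dd x (γ 0) ≤ lsc L K κ k → 2 * Lsc L K κ k < dd x (γ m) →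
      ∃ τ : List Bool → W, ProperEmbedding lam dd Lam L K κ k x τ ∧
        (∀ σ : List Bool, σ.length ≤ k →
          dd x (τ σ) ≤ 2 * Lsc L K κ k - 2 * Lsc L K κ (k - σ.length)) ∧
        ∀ σ : List Bool, σ.length ≤ k → ∃ i ≤ m, dd (τ σ) (γ i) ≤ lsc L K κ (k - σ.length) := by
  have hL0 : 0 ≤ L := by linarith
  have hK0 : 0 ≤ K := by linarith
  have hκ0 : 0 ≤ κ := by linarith
  have hLnn := Lsc_nonneg hL0 hK0 hκ0
  have hlnn := lsc_nonneg hL0 hK0 hκ0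
  have hmono := lsc_mono hL0 hK0 (by linarith : 1 ≤ κ)
  have hl1 : ∀ j, 1 ≤ lsc L K κ j := fun j => by
    have h0 : 1 ≤ lsc L K κ 0 := by
      rw [lsc_zero_eq, Lsc]
      have : 1 ≤ κ * L := by nlinarith
      nlinarith
    exact h0.trans (hmono (Nat.zero_le j))
  induction k with
  | zero =>
    intro x γ m _ h0 _
    refine ⟨fun _ => x, ⟨rfl, fun n hn => absurd hn (by omega), ?_, ?_⟩, ?_, ?_⟩
    · intro n hn σ σ' hσ hσ' hne
      refine absurd ?_ hne
      rw [List.length_eq_zero_iff.1 (by omega : σ.length = 0),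
        List.length_eq_zero_iff.1 (by omega : σ'.length = 0)]
    · intro n hn σ σ' _ _
      have h2 := hLnn 0
      have h1 := hLnn (0 - n)
      refine ⟨x, ?_, ?_⟩ <;> simp only [vball, mem_ofPred_eq, hself] <;> linarith
    · intro σ hσ
      simp [hself]
    · intro σ hσ
      exact ⟨0, Nat.zero_le _, by simpa using h0⟩
  | succ k ih =>
    intro x γ m hstep h0 hm
    have hLs := Lsc_succ_eq (L := L) (K := K) (κ := κ) k
    have hls := lsc_succ_le hL0 hK0 hκ0 k
    have hlL := lsc_le_Lsc hL0 hK0 hκ0 (k + 1)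
    have hlk := hlnn k
    have hLk := hLnn k
    have hLk1 := hLnn (k + 1)
    have hκl : 8 * lsc L K κ k ≤ κ * lsc L K κ k := mul_le_mul_of_nonneg_right hκ hlk
    obtain ⟨y₀, hy₀, hd₀⟩ := hcover _ (hl1 k) (γ 0)
    obtain ⟨i, him, hi, hafter⟩ := exists_last_le (fun j => dd x (γ j)) (Lsc L K κ (k + 1)) m
      (h0.trans hlL) (by linarith)
    have hi1 := hafter (i + 1) i.lt_succ_self him
    obtain ⟨y₁, hy₁, hd₁⟩ := hcover _ (hl1 k) (γ (i + 1))
    have hjump : dd (γ i) (γ (i + 1)) ≤ lsc L K κ k := (hstep i him).trans (hmono (Nat.zero_le k))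
    have hxy₀ : dd x y₀ ≤ lsc L K κ (k + 1) + lsc L K κ k := by
      have := htri x (γ 0) y₀
      rw [hsymm (γ 0) y₀] at this
      linarith
    have hxy₁ : dd x y₁ ≤ 2 * lsc L K κ k + Lsc L K κ (k + 1) := by
      have h1 := htri x (γ (i + 1)) y₁
      have h2 := htri x (γ i) (γ (i + 1))
      rw [hsymm (γ (i + 1)) y₁] at h1
      linarith
    have hxy₁' : Lsc L K κ (k + 1) - lsc L K κ k < dd x y₁ := by
      have := htri x y₁ (γ (i + 1))
      linarith
    obtain ⟨τ₀, hτ₀, hreach₀, hclose₀⟩ := ih y₀ γ m hstep hd₀ (by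
      have := htri x y₀ (γ m)
      linarith)
    have hidx : i + 1 + (m - (i + 1)) = m := by omega
    obtain ⟨τ₁, hτ₁, hreach₁, hclose₁⟩ := ih y₁ (fun j => γ (i + 1 + j)) (m - (i + 1))
      (fun j hj => hstep (i + 1 + j) (by omega)) hd₁ (by
        have := htri x y₁ (γ m)
        simp only [hidx]
        linarith)
    have hcross : ∀ s s' : List Bool, s.length = s'.length → s.length ≤ k →
        2 * Lsc L K κ (k - s.length) + κ * lsc L K κ (k - s.length) ≤ dd (τ₀ s) (τ₁ s') := by
      intro s s' hss hs
      have h1 := hreach₀ s hs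
      obtain ⟨j, hj, hc⟩ := hclose₁ s' (by omega)
      have h2 := hafter (i + 1 + j) (by omega) (by omega)
      rw [← hss] at hc
      have h3 := htri x (τ₁ s') (γ (i + 1 + j))
      have h4 := htri x (τ₀ s) (τ₁ s')
      have h5 := htri x y₀ (τ₀ s)
      have h6 : lsc L K κ (k - s.length) ≤ lsc L K κ k := hmono (Nat.sub_le _ _)
      have h7 : κ * lsc L K κ (k - s.length) ≤ κ * lsc L K κ k :=
        mul_le_mul_of_nonneg_left h6 hκ0
      linarith
    have hreach : ∀ σ : List Bool, σ.length ≤ k + 1 → dd x (treeJoin x τ₀ τ₁ σ) ≤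
        2 * Lsc L K κ (k + 1) - 2 * Lsc L K κ (k + 1 - σ.length) := by
      rintro (_ | ⟨_ | _, s⟩) hσ
      · simp [treeJoin, hself]
      · rw [List.length_cons] at hσ ⊢
        have h1 := hreach₀ s (by omega)
        have h2 := htri x y₀ (τ₀ s)
        rw [Nat.add_sub_add_right]
        simp only [treeJoin]
        linarith
      · rw [List.length_cons] at hσ ⊢
        have h1 := hreach₁ s (by omega)
        have h2 := htri x y₁ (τ₁ s)
        rw [Nat.add_sub_add_right]
        simp only [treeJoin]
        linarith
    refine ⟨treeJoin x τ₀ τ₁, ⟨rfl, ?_, ?_, ?_⟩, hreach, ?_⟩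
    · rintro n hn (_ | ⟨b, s⟩) hσ
      · obtain rfl : n = 0 := hσ.symm
        simp only [List.nil_append, treeJoin, hτ₀.base, hτ₁.base]
        exact ⟨⟨hy₀, hxy₀⟩, hy₁, hxy₁, not_le.2 hxy₁'⟩
      · obtain rfl : n = s.length + 1 := hσ.symm
        rw [Nat.add_sub_add_right]
        cases b
        · exact hτ₀.child s.length (by omega) s rfl
        · exact hτ₁.child s.length (by omega) s rfl
    · rintro n hn (_ | ⟨b, s⟩) (_ | ⟨b', s'⟩) hσ hσ' hne
      · exact absurd rfl hne
      · simp only [List.length_nil, List.length_cons] at hσ hσ'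
        omega
      · simp only [List.length_nil, List.length_cons] at hσ hσ'
        omega
      · obtain rfl : n = s.length + 1 := hσ.symm
        have hlen : s'.length = s.length := Nat.succ.inj hσ'
        have hs : s.length ≤ k := by omega
        rw [Nat.add_sub_add_right]
        cases b <;> cases b' <;> simp only [treeJoin]
        · exact hτ₀.sep _ hs s s' rfl hlen fun h => hne (by rw [h])
        · exact hcross s s' hlen.symm hs
        · rw [hsymm, ← hlen]
          exact hcross s' s hlen (by omega)
        · exact hτ₁.sep _ hs s s' rfl hlen fun h => hne (by rw [h])
    · rintro n hn (_ | ⟨b, s⟩) σ' hσ hσ'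
      · obtain rfl : n = 0 := hσ.symm
        have h1 := hreach σ' (by omega)
        rw [Nat.sub_zero] at hσ'
        rw [hσ', Nat.sub_self] at h1
        have h2 := hLnn 0
        refine ⟨treeJoin x τ₀ τ₁ σ', ?_, ?_⟩
        · change dd x (treeJoin x τ₀ τ₁ σ') ≤ 2 * Lsc L K κ (k + 1)
          linarith
        · simp only [vball, mem_ofPred_eq, List.nil_append, hself]
          linarith
      · obtain rfl : n = s.length + 1 := hσ.symm
        rw [Nat.add_sub_add_right] at hσ' ⊢
        cases b
        · exact hτ₀.near _ (by omega) s σ' rfl hσ'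
        · exact hτ₁.near _ (by omega) s σ' rfl hσ'
    · rintro (_ | ⟨_ | _, s⟩) hσ
      · exact ⟨0, Nat.zero_le _, h0⟩
      · rw [List.length_cons] at hσ ⊢
        rw [Nat.add_sub_add_right]
        exact hclose₀ s (by omega)
      · rw [List.length_cons] at hσ ⊢
        rw [Nat.add_sub_add_right]
        obtain ⟨j, hj, hc⟩ := hclose₁ s (by omega)
        exact ⟨i + 1 + j, by omega, hc⟩

/-- Lemma `lem:entropy`: every path crossing the annulus at
scale `k` generates a `k`-proper embedding whose bottom boxes it visits. -/
theorem statement16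
    (V : Type) [MeasurableSpace V]
    (lam dd : V → V → ℝ) (P : V → Measure (ℕ → V)) (α ν c₃ C₃ : ℝ)
    (hSt : Standing lam dd P α ν c₃ C₃)
    (Lam : ℝ → Set V) (hLam : LamFamily dd α Lam) :
    ∃ Cκ : ℝ, 1 < Cκ ∧
      ∀ L K κ : ℝ, 1 ≤ L → 2 ≤ K → Cκ ≤ κ →
      ∀ (k : ℕ) (x : V) (γ : ℕ → V) (m : ℕ),
        IsLPath lam dd Lam L γ m →
        dd x (γ 0) ≤ lsc L K κ k → ¬ dd x (γ m) ≤ 2 * Lsc L K κ k →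
        ∃ τ : List Bool → V, ProperEmbedding lam dd Lam L K κ k x τ ∧
          ∀ σ : List Bool, σ.length = k →
            (vball dd (τ σ) (lsc L K κ 0) ∩ {v : V | ∃ i ≤ m, γ i = v}).Nonempty := by
  obtain ⟨D, hD, hjump⟩ := exists_neighbor_dist_bound hSt
  refine ⟨D + 8, by linarith, fun L K κ hL hK hκ k x γ m hγ h0 hm => ?_⟩
  have hstep : ∀ i < m, dd (γ i) (γ (i + 1)) ≤ lsc L K κ 0 := by
    intro i hi
    have hl0 : (D + 8) * L ≤ lsc L K κ 0 := by
      rw [lsc_zero_eq, Lsc]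
      have h1 : (D + 8) * L ≤ κ * L := mul_le_mul_of_nonneg_right hκ (by linarith)
      have h2 : 0 ≤ κ * L := mul_nonneg (by linarith) (by linarith)
      nlinarith
    have hDL : D ≤ D * L := le_mul_of_one_le_right hD hL
    rcases hγ.2 i hi with ⟨-, a, b, ha, hb, hab⟩ | ⟨-, hab⟩
    · have h1 := hSt.dd_triangle (γ i) a (γ (i + 1))
      have h2 := hSt.dd_triangle a b (γ (i + 1))
      have h3 := hjump a b hab
      rw [hSt.dd_symm b] at h2
      linarith
    · have := hjump _ _ hab
      linarith
  obtain ⟨τ, hτ, -, hclose⟩ := exists_properEmbedding (lam := lam) hSt.dd_self hSt.dd_symm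
    hSt.dd_triangle hLam.cover hL hK (by linarith) k x γ m hstep h0 (not_le.1 hm)
  refine ⟨τ, hτ, fun σ hσ => ?_⟩
  obtain ⟨i, hi, hc⟩ := hclose σ hσ.le
  rw [hσ, Nat.sub_self] at hc
  exact ⟨γ i, hc, i, hi, rfl⟩

end Paper
end
end
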